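/- (Random grains retained.) Fix λ > 0 and a Borel probability measure F on [0,∞) with ∫ r^d F(dr) < ∞ that follows a power law with tail exponent α > d, so F̄(r) = ℓ(r)·r^{−α} with ℓ slowly varying. Define b(r) = ∫ |B_{r+s}(0)| F(ds), h(r) = (1 − e^{−λ b(r)})/(λ b(r)), a_u(r₁,r₂) = ∫ |B_{r₁+s}(0) ∩ B_{r₂+s}(u·e₁)| F(ds), and q(u, r₁, r₂) = ∫₀¹∫₀¹ e^{−λ b(r₁)(1−w₁)}·e^{−λ b(r₂)(1−w₂)}·(1{u > r₁+r₂}·e^{λ(1−max(w₁,w₂))·a_u(r₁,r₂)} − 1) dw₁ dw₂; further let λ_th = λ ∫ h(r) F(dr), F̄_th(r) = (λ/λ_th) ∫_{(r,∞)} h(s) F(ds), k_th(z) = λ ∫ |B_r(0) ∩ B_r(z)| h(r) F(dr) + λ² ∭ |B_{r₁}(0) ∩ B_{r₂}(x)|·q(|x−z|, r₁, r₂) dx F(dr₁) F(dr₂), and ξ_th(z) = (λ/λ_th)² ∬ q(|z|, r₁, r₂) F(dr₁) F(dr₂). Then: (i) F̄_th(r)/((λ_th·|B_1(0)|)^{−1}·(α/(α+d))·ℓ(r)·r^{−(α+d)})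 → 1 as r → ∞; and there exist constants c₁, c₂ ∈ (0,∞) such that (ii) k_th(z)/(c₁·ℓ(|z|)·|z|^{−(α−d)}) → 1 and (iii) ξ_th(z)/(c₂·ℓ(|z|)·|z|^{−(α−d)}) → 1 as |z| → ∞. -/

import Mathlib

open MeasureTheory Filter Set Metric ProbabilityTheory

noncomputable section

/-- A measurable positive function is slowly varying at infinity if `ℓ(a t)/ℓ(t) → 1`
as `t → ∞` for every `a > 0`. -/
def SlowlyVarying (ℓ : ℝ → ℝ) : Prop :=
  Measurable ℓ ∧ (∀ x > 0, 0 < ℓ x) ∧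
    ∀ a > 0, Tendsto (fun t => ℓ (a * t) / ℓ t) atTop (nhds 1)

/-- Tail function `F̄(x) = F((x,∞))` of a measure on `ℝ`. -/
def tailF (F : Measure ℝ) (x : ℝ) : ℝ := (F (Ioi x)).toReal

/-- `d`-dimensional Euclidean space. -/
abbrev Euc (d : ℕ) := EuclideanSpace ℝ (Fin d)

/-- The first standard basis vector of `ℝ^d`. -/
def e1 (d : ℕ) : Euc d := if h : 0 < d then EuclideanSpace.single (⟨0, h⟩ : Fin d) 1 else 0

/-- Volume of the closed ball of radius `r` in `ℝ^d`. -/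
def ballVol (d : ℕ) (r : ℝ) : ℝ := (volume (closedBall (0 : Euc d) r)).toReal

/-- Volume of the intersection of closed balls `B_r(x)` and `B_s(y)` in `ℝ^d`. -/
def interVol (d : ℕ) (x : Euc d) (r : ℝ) (y : Euc d) (s : ℝ) : ℝ :=
  (volume (closedBall x r ∩ closedBall y s)).toReal

/-- The constant `c_{α,d} = ∫₀^∞ |B_r(0) ∩ B_r(e₁)| α r^{-α-1} dr`. -/
def cconst (d : ℕ) (α : ℝ) : ℝ :=
  ∫ r in Ioi (0 : ℝ), interVol d 0 r (e1 d) r * (α * r ^ (-α - 1))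

/-- `b(r) = ∫ |B_{r+s}(0)| F(ds)`. -/
def bR (d : ℕ) (F : Measure ℝ) (r : ℝ) : ℝ := ∫ s, ballVol d (r + s) ∂F

/-- Weight-averaged retention probability for the random-retained (Matérn type II)
thinning. -/
def hR (d : ℕ) (lam : ℝ) (F : Measure ℝ) (r : ℝ) : ℝ :=
  (1 - Real.exp (-(lam * bR d F r))) / (lam * bR d F r)

/-- `a_u(r₁,r₂) = ∫ |B_{r₁+s}(0) ∩ B_{r₂+s}(u e₁)| F(ds)`. -/
def aR (d : ℕ) (F : Measure ℝ) (u r₁ r₂ : ℝ) : ℝ :=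
  ∫ s, interVol d 0 (r₁ + s) (u • e1 d) (r₂ + s) ∂F

/-- Retention covariance for the random-retained thinning. -/
def qR (d : ℕ) (lam : ℝ) (F : Measure ℝ) (u r₁ r₂ : ℝ) : ℝ :=
  ∫ w₁ in (0:ℝ)..1, ∫ w₂ in (0:ℝ)..1,
    Real.exp (-(lam * bR d F r₁ * (1 - w₁))) * Real.exp (-(lam * bR d F r₂ * (1 - w₂))) *
      ((if r₁ + r₂ < u then Real.exp (lam * (1 - max w₁ w₂) * aR d F u r₁ r₂) else 0) - 1)

/-- Thinned germ density `λ_th = λ ∫ h(r) F(dr)`. -/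
def lamth (lam : ℝ) (F : Measure ℝ) (h : ℝ → ℝ) : ℝ := lam * ∫ r, h r ∂F

/-- Tail distribution `F̄_th(r) = (λ/λ_th) ∫_{(r,∞)} h(s) F(ds)` of the radius of a
typical grain in the thinned model. -/
def tailth (lam : ℝ) (F : Measure ℝ) (h : ℝ → ℝ) (r : ℝ) : ℝ :=
  (lam / lamth lam F h) * ∫ s in Ioi r, h s ∂F

/-- Volume fraction `p_th = λ ∫ |B_r(0)| h(r) F(dr)` of the thinned grain cover. -/
def pth (d : ℕ) (lam : ℝ) (F : Measure ℝ) (h : ℝ → ℝ) : ℝ :=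
  lam * ∫ r, ballVol d r * h r ∂F

/-- Covariance function of the thinned grain cover. -/
def kth (d : ℕ) (lam : ℝ) (F : Measure ℝ) (h : ℝ → ℝ) (q : ℝ → ℝ → ℝ → ℝ)
    (z : Euc d) : ℝ :=
  lam * ∫ r, interVol d 0 r z r * h r ∂F +
    lam ^ 2 * ∫ r₁, (∫ r₂, (∫ x, interVol d 0 r₁ x r₂ * q (‖x - z‖) r₁ r₂) ∂F) ∂F

/-- Two-point correlation function of the thinned grain centers. -/
def xith (d : ℕ) (lam : ℝ) (F : Measure ℝ) (h : ℝ → ℝ) (q : ℝ → ℝ → ℝ → ℝ)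
    (z : Euc d) : ℝ :=
  (lam / lamth lam F h) ^ 2 * ∫ r₁, (∫ r₂, q ‖z‖ r₁ r₂ ∂F) ∂F



lemma tail_anti (F : Measure ℝ) [IsFiniteMeasure F] : Antitone (tailF F) := by
  intro x y hxy
  exact measureReal_mono (Ioi_subset_Ioi hxy)

lemma tail_pos {F : Measure ℝ} {α : ℝ} {ℓ : ℝ → ℝ} (hℓ : SlowlyVarying ℓ)
    (htail : ∀ x > 0, tailF F x = ℓ x * x ^ (-α)) : ∀ x > 0, 0 < tailF F x := by
  intro x hx
  rw [htail x hx]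
  exact mul_pos (hℓ.2.1 x hx) (Real.rpow_pos_of_pos hx _)

lemma tail_rv {F : Measure ℝ} {α : ℝ} {ℓ : ℝ → ℝ} (hℓ : SlowlyVarying ℓ)
    (htail : ∀ x > 0, tailF F x = ℓ x * x ^ (-α)) :
    ∀ a > 0, Tendsto (fun u => tailF F (a * u) / tailF F u) atTop (nhds (a ^ (-α))) := by
  intro a ha
  have h := (hℓ.2.2 a ha).mul_const (a ^ (-α))
  rw [one_mul] at h
  refine h.congr' ?_
  filter_upwards [eventually_gt_atTop 0] with u hu
  rw [htail _ (mul_pos ha hu), htail u hu, Real.mul_rpow ha.le hu.le]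
  have := (Real.rpow_pos_of_pos hu (-α)).ne'
  have := (hℓ.2.1 u hu).ne'
  field_simp

/-- Bundle of the regular variation facts about the tail. -/
structure RV (F : Measure ℝ) (α : ℝ) : Prop where
  pos : ∀ x > 0, 0 < tailF F x
  anti : Antitone (tailF F)
  lim : ∀ a > 0, Tendsto (fun u => tailF F (a * u) / tailF F u) atTop (nhds (a ^ (-α)))

lemma RV.bdd {F : Measure ℝ} {α : ℝ} (h : RV F α) {a : ℝ} (ha : 0 < a) :
    ∃ K > 0, ∃ u0 > 0, ∀ u ≥ u0, tailF F (a * u) ≤ K * tailF F u := by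
  have h1 := (h.lim a ha).eventually_lt_const (lt_add_one (a ^ (-α)))
  obtain ⟨u0, hu0⟩ := eventually_atTop.1 h1
  refine ⟨a ^ (-α) + 1, by positivity, max u0 1, by positivity, fun u hu => ?_⟩
  have h2 := hu0 u (le_trans (le_max_left _ _) hu)
  have hup : 0 < u := lt_of_lt_of_le one_pos (le_trans (le_max_right _ _) hu)
  rw [div_lt_iff₀ (h.pos u hup)] at h2
  exact h2.le

lemma RV.potter {F : Measure ℝ} {α : ℝ} (h : RV F α) {β m : ℝ} (hβ0 : 0 < β) (hβ : β < α)
    (hm : 0 < m) :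
    ∃ K > 0, ∃ u0 > 0, ∀ u ≥ u0, ∀ t ≥ m, tailF F (t * u) ≤ K * t ^ (-β) * tailF F u := by
  have h2 : (2 : ℝ) ^ (-α) < 2 ^ (-β) := Real.rpow_lt_rpow_of_exponent_lt (by norm_num) (by linarith)
  obtain ⟨u1, hu1⟩ := eventually_atTop.1 ((h.lim 2 two_pos).eventually_lt_const h2)
  obtain ⟨K, hK, u2, hu2, hKu⟩ := h.bdd hm
  refine ⟨max K (2 ^ β), by positivity, max (max u1 u2) 1, by positivity, fun u hu t ht => ?_⟩
  have hu1' : u1 ≤ u := le_trans (le_trans (le_max_left _ _) (le_max_left _ _)) hu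
  have hu2' : u2 ≤ u := le_trans (le_trans (le_max_right _ _) (le_max_left _ _)) hu
  have hup : 0 < u := lt_of_lt_of_le one_pos (le_trans (le_max_right _ _) hu)
  have htp : 0 < t := lt_of_lt_of_le hm ht
  have hTp := h.pos u hup
  rcases le_total t 1 with ht1 | ht1
  · calc tailF F (t * u) ≤ tailF F (m * u) := h.anti (by gcongr)
      _ ≤ K * tailF F u := hKu u hu2'
      _ = K * 1 * tailF F u := by ring
      _ ≤ max K (2 ^ β) * t ^ (-β) * tailF F u := by
        gcongr
        · exact le_max_left _ _
        · exact Real.one_le_rpow_of_pos_of_le_one_of_nonpos htp ht1 (by linarith)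
  · obtain ⟨n, hn1, hn2⟩ := exists_nat_pow_near ht1 (one_lt_two)
    have key : ∀ n : ℕ, tailF F (2 ^ n * u) ≤ ((2 : ℝ) ^ (-β)) ^ n * tailF F u := by
      intro n
      induction n with
      | zero => simp
      | succ k ih =>
        have hk : u ≤ 2 ^ k * u := le_mul_of_one_le_left hup.le (one_le_pow₀ (by norm_num))
        have h3 := hu1 (2 ^ k * u) (hu1'.trans hk)
        rw [div_lt_iff₀ (h.pos _ (by positivity))] at h3
        calc tailF F (2 ^ (k+1) * u) = tailF F (2 * (2 ^ k * u)) := by ring_nf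
          _ ≤ 2 ^ (-β) * tailF F (2 ^ k * u) := h3.le
          _ ≤ 2 ^ (-β) * (((2 : ℝ) ^ (-β)) ^ k * tailF F u) := by gcongr
          _ = _ := by ring
    calc tailF F (t * u) ≤ tailF F (2 ^ n * u) := h.anti (by gcongr)
      _ ≤ ((2 : ℝ) ^ (-β)) ^ n * tailF F u := key n
      _ ≤ max K (2 ^ β) * t ^ (-β) * tailF F u := by
        gcongr
        calc ((2 : ℝ) ^ (-β)) ^ n = 2 ^ β * ((2 : ℝ) ^ (n + 1)) ^ (-β) := by
              rw [← Real.rpow_natCast, ← Real.rpow_natCast, ← Real.rpow_mul (by norm_num),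
                ← Real.rpow_mul (by norm_num), ← Real.rpow_add (by norm_num)]
              congr 1; push_cast; ring
          _ ≤ 2 ^ β * t ^ (-β) := by
              gcongr 2 ^ β * ?_
              exact Real.rpow_le_rpow_of_nonpos htp hn2.le (by linarith)
          _ ≤ _ := by
              gcongr
              exact le_max_right _ _

lemma rpow_cont_aux {τ : ℝ} (hτ : 0 < τ) (α b : ℝ) (hb : τ ^ (-α) < b) :
    ∃ τ', 0 < τ' ∧ τ' < τ ∧ τ' ^ (-α) < b := by
  have hc : ContinuousAt (fun x : ℝ => x ^ (-α)) τ := Real.continuousAt_rpow_const _ _ (Or.inl hτ.ne')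
  have h1 := (hc.eventually_lt_const hb).filter_mono (nhdsWithin_le_nhds (s := Iio τ))
  have h2 : ∀ᶠ x in nhdsWithin τ (Iio τ), x < τ := self_mem_nhdsWithin
  have h3 : ∀ᶠ x in nhdsWithin τ (Iio τ), 0 < x :=
    ((continuousAt_id).eventually_const_lt hτ).filter_mono nhdsWithin_le_nhds
  obtain ⟨x, ⟨hx1, hx2⟩, hx3⟩ := ((h1.and h2).and h3).exists
  exact ⟨x, hx3, hx2, hx1⟩

lemma rpow_cont_aux' {τ : ℝ} (hτ : 0 < τ) (α b : ℝ) (hb : b < τ ^ (-α)) :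
    ∃ τ', τ < τ' ∧ b < τ' ^ (-α) := by
  have hc : ContinuousAt (fun x : ℝ => x ^ (-α)) τ := Real.continuousAt_rpow_const _ _ (Or.inl hτ.ne')
  have h1 := (hc.eventually_const_lt hb).filter_mono (nhdsWithin_le_nhds (s := Ioi τ))
  have h2 : ∀ᶠ x in nhdsWithin τ (Ioi τ), τ < x := self_mem_nhdsWithin
  obtain ⟨x, hx1, hx2⟩ := (h1.and h2).exists
  exact ⟨x, hx2, hx1⟩

lemma RV.upset_lim {F : Measure ℝ} [IsFiniteMeasure F] {α : ℝ} (h : RV F α) {φ : ℝ → ℝ} {y τ : ℝ}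
    (hτ : 0 < τ) (h1 : ∀ t > τ, y < φ t) (h2 : ∀ t < τ, φ t ≤ y) :
    Tendsto (fun u => F.real {s | y < φ (s / u)} / tailF F u) atTop (nhds (τ ^ (-α))) := by
  refine tendsto_order.2 ⟨fun b hb => ?_, fun b hb => ?_⟩
  · filter_upwards [(h.lim τ hτ).eventually_const_lt hb, eventually_gt_atTop 0] with u hu hup
    refine hu.trans_le ?_
    have := h.pos u hup
    gcongr
    refine measureReal_mono fun s hs => ?_
    exact h1 _ ((lt_div_iff₀ hup).2 hs)
  · obtain ⟨τ', h0, hlt, hb'⟩ := rpow_cont_aux hτ α b hb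
    filter_upwards [(h.lim τ' h0).eventually_lt_const hb', eventually_gt_atTop 0] with u hu hup
    refine lt_of_le_of_lt ?_ hu
    have := h.pos u hup
    gcongr
    refine measureReal_mono fun s hs => ?_
    by_contra hcon
    have h3 : s / u < τ := lt_of_le_of_lt ((div_le_iff₀ hup).2 (not_lt.1 hcon)) hlt
    exact absurd (h2 _ h3) (not_le.2 hs)

lemma RV.equiv {F : Measure ℝ} {α : ℝ} (h : RV F α) {ι : Type*} {l : Filter ι}
    {U V : ι → ℝ} (hV : Tendsto V l atTop) (hUV : Tendsto (fun i => U i / V i) l (nhds 1)) :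
    Tendsto (fun i => tailF F (U i) / tailF F (V i)) l (nhds 1) := by
  refine tendsto_order.2 ⟨fun b hb => ?_, fun b hb => ?_⟩
  · obtain ⟨τ', hlt, hb'⟩ := rpow_cont_aux' one_pos α b (by simpa using hb)
    have h0 : 0 < τ' := one_pos.trans hlt
    filter_upwards [hV.eventually ((h.lim τ' h0).eventually_const_lt hb'),
      hV.eventually (eventually_gt_atTop 0), hUV.eventually_lt_const hlt] with i h1 h2 h3
    refine h1.trans_le ?_
    have := h.pos _ h2
    gcongr
    apply h.anti
    exact ((div_lt_iff₀ h2).1 h3).le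
  · obtain ⟨τ', h0, hlt, hb'⟩ := rpow_cont_aux one_pos α b (by simpa using hb)
    filter_upwards [hV.eventually ((h.lim τ' h0).eventually_lt_const hb'),
      hV.eventually (eventually_gt_atTop 0), hUV.eventually_const_lt hlt] with i h1 h2 h3
    refine lt_of_le_of_lt ?_ h1
    have := h.pos _ h2
    gcongr
    apply h.anti
    exact ((lt_div_iff₀ h2).1 h3).le

lemma RV.karamata {F : Measure ℝ} [IsFiniteMeasure F] {α : ℝ} (h : RV F α) {d : ℕ} (hd : 0 < d)
    (hα : (d : ℝ) < α) {φ : ℝ → ℝ} (hφ0 : ∀ t, 0 ≤ φ t) {C : ℝ} (hC : 0 < C)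
    (hφC : ∀ t, 0 < φ t → 0 < t ∧ φ t + 1 ≤ C * t ^ d)
    (hInt : ∀ u > 0, Integrable (fun s => φ (s / u)) F) {γ : ℝ → ℝ}
    (hγ : ∀ y > 0, Tendsto (fun u => F.real {s | y < φ (s / u)} / tailF F u) atTop (nhds (γ y))) :
    Tendsto (fun u => (∫ s, φ (s / u) ∂F) / tailF F u) atTop (nhds (∫ y in Ioi 0, γ y)) := by
  obtain ⟨β, hβ1, hβ2⟩ := exists_between hα
  have hdp : (0 : ℝ) < d := by exact_mod_cast hd
  have hβ0 : 0 < β := hdp.trans hβ1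
  set D := 1 / (2 * C) with hD
  have hDp : 0 < D := by positivity
  obtain ⟨K, hK, u0, hu0, hpot⟩ := h.potter hβ0 hβ2 (Real.rpow_pos_of_pos hDp (1 / (d:ℝ)))
  have hev : ∀ᶠ u in atTop, (∫ s, φ (s / u) ∂F) / tailF F u
      = ∫ y in Ioi 0, F.real {s | y < φ (s / u)} / tailF F u := by
    filter_upwards [eventually_gt_atTop 0] with u hu
    rw [(hInt u hu).integral_eq_integral_meas_lt (Eventually.of_forall fun s => hφ0 _),
      integral_div]
  refine Tendsto.congr' (EventuallyEq.symm hev) ?_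
  refine tendsto_integral_filter_of_dominated_convergence
    (fun y => (K * D ^ (-(β / d))) * (y + 1) ^ (-(β / d))) ?_ ?_ ?_ ?_
  · refine Eventually.of_forall fun u => ?_
    have : Antitone (fun y => F.real {s | y < φ (s / u)}) := fun a b hab =>
      measureReal_mono fun s hs => lt_of_le_of_lt hab hs
    exact (this.measurable.div_const _).aestronglyMeasurable
  · filter_upwards [eventually_ge_atTop u0] with u hu
    refine (ae_restrict_mem measurableSet_Ioi).mono fun y hy => ?_
    have hy : 0 < y := hy
    have hup : 0 < u := hu0.trans_le hu
    have hTp := h.pos u hup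
    rw [Real.norm_of_nonneg (by positivity), div_le_iff₀ hTp]
    set t := (D * (y + 1)) ^ (1 / (d:ℝ)) with ht
    have htm : D ^ (1 / (d:ℝ)) ≤ t := by
      apply Real.rpow_le_rpow hDp.le _ (by positivity)
      nlinarith
    have h1 := hpot u hu t htm
    have h2 : t ^ (-β) = D ^ (-(β / d)) * (y + 1) ^ (-(β / d)) := by
      rw [ht, ← Real.rpow_mul (by positivity), ← Real.mul_rpow (by positivity) (by positivity)]
      congr 1; field_simp
    rw [h2] at h1
    calc F.real {s | y < φ (s / u)} ≤ tailF F (t * u) := by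
          refine measureReal_mono fun s hs => ?_
          have hs : y < φ (s / u) := hs
          obtain ⟨h3, h4⟩ := hφC _ (hy.trans hs)
          rw [mem_Ioi, ← lt_div_iff₀ hup, ht]
          have h5 : D * (y + 1) < (s / u) ^ d := by
            rw [hD, one_div, inv_mul_lt_iff₀ (by positivity)]
            have : 0 < C * (s/u)^d := by positivity
            nlinarith
          calc (D * (y + 1)) ^ (1 / (d:ℝ)) < ((s / u) ^ d) ^ (1 / (d:ℝ)) :=
                Real.rpow_lt_rpow (by positivity) h5 (by positivity)
            _ = s / u := by
                rw [one_div]; exact Real.pow_rpow_inv_natCast h3.le hd.ne'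
      _ ≤ _ := by
          refine h1.trans (le_of_eq ?_); ring
  · refine Integrable.const_mul ?_ _
    have : -(β / d) < -1 := by
      rw [neg_lt_neg_iff, lt_div_iff₀ hdp]; linarith
    exact integrableOn_add_rpow_Ioi_of_lt this (by norm_num)
  · refine (ae_restrict_mem measurableSet_Ioi).mono fun y hy => hγ y hy

lemma RV.upset_ex {F : Measure ℝ} [IsFiniteMeasure F] {α : ℝ} (h : RV F α) {φ : ℝ → ℝ}
    (hφ : Monotone φ) {m : ℝ} (hm : 0 < m) (hφm : ∀ t < m, φ t ≤ 0) {y : ℝ} (hy : 0 < y) :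
    ∃ g, Tendsto (fun u => F.real {s | y < φ (s / u)} / tailF F u) atTop (nhds g) := by
  by_cases hne : ∃ t, y < φ t
  · have hb : BddBelow {t | y < φ t} := ⟨m, fun t ht => by
      by_contra hcon
      have : y < φ t := ht
      linarith [hφm t (not_le.1 hcon)]⟩
    refine ⟨_, h.upset_lim (τ := sInf {t | y < φ t}) ?_ ?_ ?_⟩
    · refine hm.trans_le (le_csInf hne fun t ht => ?_)
      by_contra hcon
      have : y < φ t := ht
      linarith [hφm t (not_le.1 hcon)]
    · intro t ht
      obtain ⟨t', ht', hlt⟩ := exists_lt_of_csInf_lt hne ht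
      exact lt_of_lt_of_le ht' (hφ hlt.le)
    · intro t ht
      by_contra hcon
      exact absurd (csInf_le hb (not_le.1 hcon : y < φ t)) (not_le.2 ht)
  · push Not at hne
    refine ⟨0, ?_⟩
    have : ∀ u, {s | y < φ (s / u)} = ∅ := fun u => by
      ext s; simpa using hne _
    simp [this]

lemma RV.karamata_ex {F : Measure ℝ} [IsFiniteMeasure F] {α : ℝ} (h : RV F α) {d : ℕ} (hd : 0 < d)
    (hα : (d : ℝ) < α) {φ : ℝ → ℝ} (hφ : Monotone φ) (hφ0 : ∀ t, 0 ≤ φ t) {C : ℝ} (hC : 0 < C)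
    {m : ℝ} (hm : 0 < m) (hφm : ∀ t < m, φ t ≤ 0)
    (hφC : ∀ t, 0 < φ t → 0 < t ∧ φ t + 1 ≤ C * t ^ d)
    (hInt : ∀ u > 0, Integrable (fun s => φ (s / u)) F) {t0 : ℝ} (ht0 : 0 < φ t0) :
    ∃ L > 0, Tendsto (fun u => (∫ s, φ (s / u) ∂F) / tailF F u) atTop (nhds L) := by
  have hex : ∀ y, ∃ g, 0 < y →
      Tendsto (fun u => F.real {s | y < φ (s / u)} / tailF F u) atTop (nhds g) := by
    intro y
    by_cases hy : 0 < y
    · obtain ⟨g, hg⟩ := h.upset_ex hφ hm hφm hy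
      exact ⟨g, fun _ => hg⟩
    · exact ⟨0, fun h => absurd h hy⟩
  choose γ hγ using hex
  have hk := h.karamata hd hα hφ0 hC hφC hInt hγ
  refine ⟨_, ?_, hk⟩
  have ht0p := (hφC t0 ht0).1
  have hl := (h.lim t0 ht0p).const_mul (φ t0)
  refine lt_of_lt_of_le (mul_pos ht0 (Real.rpow_pos_of_pos ht0p (-α))) (le_of_tendsto_of_tendsto hl hk ?_)
  filter_upwards [eventually_gt_atTop 0] with u hu
  have := h.pos u hu
  rw [← mul_div_assoc]
  gcongr
  calc φ t0 * tailF F (t0 * u) = ∫ s in Ioi (t0 * u), φ t0 ∂F := by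
        simp [tailF, mul_comm, Measure.real]
    _ ≤ ∫ s in Ioi (t0 * u), φ (s / u) ∂F := by
        refine setIntegral_mono_on (integrable_const _) (hInt u hu).integrableOn measurableSet_Ioi
          fun s hs => hφ ?_
        exact ((lt_div_iff₀ hu).2 hs).le
    _ ≤ _ := setIntegral_le_integral (hInt u hu) (Eventually.of_forall fun s => hφ0 _)


lemma vol_closedBall_ne_top (d : ℕ) (x : Euc d) (r : ℝ) : volume (closedBall x r) ≠ ⊤ :=
  (measure_closedBall_lt_top).ne

lemma ballVol_center (d : ℕ) (x : Euc d) (r : ℝ) :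
    (volume (closedBall x r)).toReal = ballVol d r := by
  unfold ballVol
  rw [Measure.addHaar_closedBall_center]

lemma ballVol_nonneg (d : ℕ) (r : ℝ) : 0 ≤ ballVol d r := ENNReal.toReal_nonneg

lemma ballVol_mono (d : ℕ) : Monotone (ballVol d) := fun _ _ h =>
  ENNReal.toReal_mono (vol_closedBall_ne_top d _ _) (measure_mono (closedBall_subset_closedBall h))

lemma ballVol_eq (d : ℕ) {r : ℝ} (hr : 0 ≤ r) : ballVol d r = ballVol d 1 * r ^ d := by
  unfold ballVol
  rw [Measure.addHaar_closedBall _ _ hr, Measure.addHaar_closedBall _ _ zero_le_one]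
  simp [ENNReal.toReal_mul, ENNReal.toReal_ofReal (pow_nonneg hr d), mul_comm]

lemma ballVol_pos (d : ℕ) {r : ℝ} (hr : 0 < r) : 0 < ballVol d r :=
  ENNReal.toReal_pos (measure_closedBall_pos _ _ hr).ne' (vol_closedBall_ne_top d _ _)

lemma interVol_nonneg (d : ℕ) (x : Euc d) (r : ℝ) (y : Euc d) (s : ℝ) : 0 ≤ interVol d x r y s :=
  ENNReal.toReal_nonneg

lemma interVol_le_left (d : ℕ) (x : Euc d) (r : ℝ) (y : Euc d) (s : ℝ) :
    interVol d x r y s ≤ ballVol d r := by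
  rw [← ballVol_center d x r]
  exact ENNReal.toReal_mono (vol_closedBall_ne_top d _ _) (measure_mono inter_subset_left)

lemma interVol_le_right (d : ℕ) (x : Euc d) (r : ℝ) (y : Euc d) (s : ℝ) :
    interVol d x r y s ≤ ballVol d s := by
  rw [← ballVol_center d y s]
  exact ENNReal.toReal_mono (vol_closedBall_ne_top d _ _) (measure_mono inter_subset_right)

lemma interVol_mono (d : ℕ) (x : Euc d) {r r' : ℝ} (y : Euc d) {s s' : ℝ} (h : r ≤ r') (h' : s ≤ s') :
    interVol d x r y s ≤ interVol d x r' y s' :=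
  ENNReal.toReal_mono (measure_ne_top_of_subset inter_subset_left (vol_closedBall_ne_top d _ _))
    (measure_mono (inter_subset_inter (closedBall_subset_closedBall h)
      (closedBall_subset_closedBall h')))

lemma interVol_eq_zero (d : ℕ) (x : Euc d) (r : ℝ) (y : Euc d) (s : ℝ) (h : r + s < dist x y) :
    interVol d x r y s = 0 := by
  unfold interVol
  rw [(closedBall_disjoint_closedBall h).inter_eq]
  simp

open scoped Pointwise in
lemma interVol_scale (d : ℕ) (e : Euc d) {u : ℝ} (hu : 0 < u) (t : ℝ) :
    interVol d 0 (u * t) (u • e) (u * t) = u ^ d * interVol d 0 t e t := by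
  unfold interVol
  have h1 : closedBall (0 : Euc d) (u * t) ∩ closedBall (u • e) (u * t)
      = u • (closedBall (0 : Euc d) t ∩ closedBall e t) := by
    rw [smul_set_inter₀ hu.ne', smul_closedBall' hu.ne', smul_closedBall' hu.ne',
      Real.norm_of_nonneg hu.le, smul_zero]
  rw [h1, Measure.addHaar_smul]
  simp [ENNReal.toReal_mul, abs_of_pos hu]
  left; positivity

lemma norm_e1 {d : ℕ} (hd : 0 < d) : ‖e1 d‖ = 1 := by
  simp [e1, hd]

lemma interVol_pos_mid (d : ℕ) (x : Euc d) (r : ℝ) (y : Euc d) (s : ℝ) {ε : ℝ} (hε : 0 < ε)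
    (h1 : dist x y / 2 + ε ≤ r) (h2 : dist x y / 2 + ε ≤ s) : 0 < interVol d x r y s := by
  refine lt_of_lt_of_le (ballVol_pos d hε) ?_
  rw [← ballVol_center d (midpoint ℝ x y) ε]
  refine ENNReal.toReal_mono (measure_ne_top_of_subset inter_subset_left
    (vol_closedBall_ne_top d _ _)) (measure_mono ?_)
  refine subset_inter (closedBall_subset_closedBall' ?_) (closedBall_subset_closedBall' ?_)
  · rw [dist_midpoint_left]; simp; linarith
  · rw [dist_midpoint_right]; simp; linarith

lemma interVol_measurable (d : ℕ) :
    Measurable (fun p : (Euc d × ℝ) × (Euc d × ℝ) => interVol d p.1.1 p.1.2 p.2.1 p.2.2) := by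
  unfold interVol
  refine Measurable.ennreal_toReal ?_
  have hs : MeasurableSet {q : ((Euc d × ℝ) × (Euc d × ℝ)) × Euc d |
      dist q.2 q.1.1.1 ≤ q.1.1.2 ∧ dist q.2 q.1.2.1 ≤ q.1.2.2} := by
    refine MeasurableSet.inter (s₁ := {q : ((Euc d × ℝ) × (Euc d × ℝ)) × Euc d |
      dist q.2 q.1.1.1 ≤ q.1.1.2}) (s₂ := {q : ((Euc d × ℝ) × (Euc d × ℝ)) × Euc d |
      dist q.2 q.1.2.1 ≤ q.1.2.2}) ?_ ?_
    · exact measurableSet_le (by fun_prop) (by fun_prop)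
    · exact measurableSet_le (by fun_prop) (by fun_prop)
  exact measurable_measure_prodMk_left hs

section withF
set_option linter.unusedSectionVars false
variable {d : ℕ} {F : Measure ℝ} [IsProbabilityMeasure F]

lemma ballVol_integrable (hmom : Integrable (fun r : ℝ => r ^ d) F) (r : ℝ) :
    Integrable (fun s => ballVol d (r + s)) F := by
  have h1 : Integrable (fun s : ℝ => ballVol d 1 * (2 ^ (d-1) * (|r| ^ d + ‖s ^ d‖))) F :=
    (((integrable_const _).add hmom.norm).const_mul _).const_mul _
  refine h1.mono' ((ballVol_mono d).measurable.comp (by fun_prop)).aestronglyMeasurable ?_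
  refine Eventually.of_forall fun s => ?_
  rw [Real.norm_of_nonneg (ballVol_nonneg d _)]
  calc ballVol d (r + s) ≤ ballVol d (|r| + |s|) :=
        ballVol_mono d (add_le_add (le_abs_self _) (le_abs_self _))
    _ = ballVol d 1 * (|r| + |s|) ^ d := ballVol_eq d (by positivity)
    _ ≤ _ := by
      have := ballVol_nonneg d 1
      gcongr
      simpa using add_pow_le (abs_nonneg r) (abs_nonneg s) d

lemma bR_nonneg (r : ℝ) : 0 ≤ bR d F r := integral_nonneg fun _ => ballVol_nonneg d _

lemma bR_mono (hmom : Integrable (fun r : ℝ => r ^ d) F) : Monotone (bR d F) := fun a b h =>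
  integral_mono (ballVol_integrable hmom a) (ballVol_integrable hmom b)
    fun s => ballVol_mono d (by gcongr)

lemma interVol_integrable (hmom : Integrable (fun r : ℝ => r ^ d) F) (x y : Euc d) (r₁ r₂ : ℝ) :
    Integrable (fun s => interVol d x (r₁ + s) y (r₂ + s)) F := by
  refine (ballVol_integrable hmom r₁).mono' ?_ (Eventually.of_forall fun s => ?_)
  · exact ((interVol_measurable d).comp
      (f := fun s : ℝ => ((x, r₁ + s), (y, r₂ + s))) (by fun_prop)).aestronglyMeasurable
  · rw [Real.norm_of_nonneg (interVol_nonneg ..)]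
    exact interVol_le_left ..

lemma aR_nonneg (u r₁ r₂ : ℝ) : 0 ≤ aR d F u r₁ r₂ := integral_nonneg fun _ => interVol_nonneg ..

lemma aR_le_left (hmom : Integrable (fun r : ℝ => r ^ d) F) (u r₁ r₂ : ℝ) :
    aR d F u r₁ r₂ ≤ bR d F r₁ :=
  integral_mono (interVol_integrable hmom _ _ _ _) (ballVol_integrable hmom _)
    fun _ => interVol_le_left ..

lemma aR_le_right (hmom : Integrable (fun r : ℝ => r ^ d) F) (u r₁ r₂ : ℝ) :
    aR d F u r₁ r₂ ≤ bR d F r₂ :=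
  integral_mono (interVol_integrable hmom _ _ _ _) (ballVol_integrable hmom _)
    fun _ => interVol_le_right ..

lemma aR_measurable : Measurable (fun p : ℝ × ℝ × ℝ => aR d F p.1 p.2.1 p.2.2) := by
  unfold aR
  have : StronglyMeasurable (Function.uncurry (fun (p : ℝ × ℝ × ℝ) (s : ℝ) =>
      interVol d 0 (p.2.1 + s) (p.1 • e1 d) (p.2.2 + s))) := by
    refine Measurable.stronglyMeasurable ?_
    exact (interVol_measurable d).comp
      (f := fun q : (ℝ × ℝ × ℝ) × ℝ => (((0 : Euc d), q.1.2.1 + q.2), (q.1.1 • e1 d, q.1.2.2 + q.2)))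
      (by fun_prop)
  exact this.integral_prod_right.measurable

lemma bR_lower (hmom : Integrable (fun r : ℝ => r ^ d) F) (hs : ∀ᵐ s ∂F, 0 ≤ s) (r : ℝ) :
    ballVol d r ≤ bR d F r := by
  have : ballVol d r = ∫ _s, ballVol d r ∂F := by simp
  rw [this]
  refine integral_mono_ae (integrable_const _) (ballVol_integrable hmom _) ?_
  filter_upwards [hs] with s h
  exact ballVol_mono d (by linarith)

lemma bR_pos (hmom : Integrable (fun r : ℝ => r ^ d) F) {α : ℝ} (h : RV F α) {r : ℝ} (hr : 0 ≤ r) :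
    0 < bR d F r := by
  refine lt_of_lt_of_le ?_ (setIntegral_le_integral (s := Ioi 1) (ballVol_integrable hmom r)
    (Eventually.of_forall fun s => ballVol_nonneg d _))
  have h1 : ∫ s in Ioi 1, ballVol d 1 ∂F ≤ ∫ s in Ioi 1, ballVol d (r + s) ∂F := by
    refine setIntegral_mono_on (integrable_const _) (ballVol_integrable hmom _).integrableOn
      measurableSet_Ioi fun s hs => ballVol_mono d ?_
    have : 1 < s := hs
    linarith
  refine lt_of_lt_of_le ?_ h1
  have := h.pos 1 one_pos
  have h2 := ballVol_pos d one_pos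
  simp only [integral_const, smul_eq_mul]
  refine mul_pos ?_ h2
  simpa [tailF, Measure.real] using this

lemma hR_measurable (hmom : Integrable (fun r : ℝ => r ^ d) F) (lam : ℝ) :
    Measurable (hR d lam F) := by
  unfold hR
  have := (bR_mono hmom).measurable
  fun_prop

lemma hR_nonneg {lam : ℝ} (hlam : 0 < lam) (r : ℝ) : 0 ≤ hR d lam F r := by
  have := bR_nonneg (d := d) (F := F) r
  unfold hR
  apply div_nonneg _ (by positivity)
  have : Real.exp (-(lam * bR d F r)) ≤ 1 := Real.exp_le_one_iff.2 (by
    have : 0 ≤ lam * bR d F r := by positivity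
    linarith)
  linarith

lemma hR_le_one {lam : ℝ} (hlam : 0 < lam) (r : ℝ) : hR d lam F r ≤ 1 := by
  have := bR_nonneg (d := d) (F := F) r
  unfold hR
  apply div_le_one_of_le₀ _ (by positivity)
  have := Real.add_one_le_exp (-(lam * bR d F r))
  linarith

lemma hR_pos (hmom : Integrable (fun r : ℝ => r ^ d) F) {α : ℝ} (h : RV F α)
    {lam : ℝ} (hlam : 0 < lam) {r : ℝ} (hr : 0 ≤ r) : 0 < hR d lam F r := by
  have := bR_pos hmom h hr
  have h3 : 0 < lam * bR d F r := by positivity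
  unfold hR
  apply div_pos _ (by positivity)
  have : Real.exp (-(lam * bR d F r)) < 1 := by
    rw [← Real.exp_zero]; exact Real.exp_lt_exp.2 (by linarith)
  linarith

lemma hR_le (hmom : Integrable (fun r : ℝ => r ^ d) F) {α : ℝ} (h : RV F α)
    {lam : ℝ} (hlam : 0 < lam) {r : ℝ} (hr : 0 ≤ r) (hs : ∀ᵐ s ∂F, 0 ≤ s) :
    hR d lam F r * ballVol d r ≤ 1 / lam := by
  have h1 := bR_pos hmom h hr
  have h2 := bR_lower hmom hs r
  have h3 : 0 < lam * bR d F r := by positivity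
  calc hR d lam F r * ballVol d r ≤ hR d lam F r * bR d F r := by
        gcongr; exact hR_nonneg hlam r
    _ = (1 - Real.exp (-(lam * bR d F r))) / lam := by
        unfold hR; field_simp
    _ ≤ 1 / lam := by
        gcongr
        linarith [Real.exp_pos (-(lam * bR d F r))]

lemma hR_integrable (hmom : Integrable (fun r : ℝ => r ^ d) F) {lam : ℝ} (hlam : 0 < lam) :
    Integrable (hR d lam F) F := by
  refine (integrable_const (1:ℝ)).mono' (hR_measurable hmom lam).aestronglyMeasurable
    (Eventually.of_forall fun r => ?_)
  rw [Real.norm_of_nonneg (hR_nonneg hlam r)]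
  exact hR_le_one hlam r

lemma lamth_pos (hmom : Integrable (fun r : ℝ => r ^ d) F) {α : ℝ} (h : RV F α)
    {lam : ℝ} (hlam : 0 < lam) (hs : ∀ᵐ s ∂F, 0 ≤ s) : 0 < lamth lam F (hR d lam F) := by
  unfold lamth
  refine mul_pos hlam ?_
  rw [integral_pos_iff_support_of_nonneg (fun r => hR_nonneg hlam r) (hR_integrable hmom hlam)]
  have : ∀ᵐ s ∂F, s ∈ Function.support (hR d lam F) := by
    filter_upwards [hs] with s h0
    exact (hR_pos hmom h hlam h0).ne'
  have h1 : F (Function.support (hR d lam F)) = 1 := by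
    rw [← prob_compl_eq_zero_iff (measurableSet_support (hR_measurable hmom lam))]
    exact this
  exact h1 ▸ one_pos

lemma bR_asymp (hmom : Integrable (fun r : ℝ => r ^ d) F) (hs : ∀ᵐ s ∂F, 0 ≤ s) :
    Tendsto (fun r => bR d F r / ballVol d r) atTop (nhds 1) := by
  have hd : Tendsto (fun r : ℝ => ∫ s, ballVol d (r + s) / ballVol d r ∂F) atTop
      (nhds (∫ _s, 1 ∂F)) := by
    refine tendsto_integral_filter_of_dominated_convergence
      (fun s => ballVol d (1 + s) / ballVol d 1) ?_ ?_ ?_ ?_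
    · refine Eventually.of_forall fun r => ?_
      exact ((ballVol_integrable hmom r).div_const _).aestronglyMeasurable
    · filter_upwards [eventually_ge_atTop 1] with r hr
      filter_upwards [hs] with s h0
      have hr0 : 0 < r := by linarith
      have hw := ballVol_pos d one_pos
      rw [Real.norm_of_nonneg (div_nonneg (ballVol_nonneg ..) (ballVol_nonneg ..)),
        div_le_div_iff₀ (ballVol_pos d hr0) hw, ballVol_eq d (r := r + s) (by linarith),
        ballVol_eq d (r := 1 + s) (by linarith), ballVol_eq d hr0.le]
      have : (r + s) ^ d ≤ ((1 + s) * r) ^ d := by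
        gcongr; nlinarith
      rw [mul_pow] at this
      have h2 : 0 ≤ ballVol d 1 * ballVol d 1 := by positivity
      nlinarith [mul_le_mul_of_nonneg_left this h2]
    · exact (ballVol_integrable hmom 1).div_const _
    · filter_upwards [hs] with s h0
      have h1 : Tendsto (fun r : ℝ => (1 + s * r⁻¹) ^ d) atTop (nhds ((1 + s * 0) ^ d)) :=
        ((tendsto_inv_atTop_zero.const_mul s).const_add 1).pow d
      simp only [mul_zero, add_zero, one_pow] at h1
      refine h1.congr' ?_
      filter_upwards [eventually_gt_atTop 0] with r hr
      have hw := (ballVol_pos d one_pos).ne'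
      rw [ballVol_eq d (r := r + s) (by linarith), ballVol_eq d hr.le, mul_div_mul_left _ _ hw,
        ← div_pow]
      congr 1; field_simp
  simp only [integral_const, smul_eq_mul, mul_one] at hd
  simpa [integral_div, bR] using hd

lemma hR_asymp (hd : 0 < d) (hmom : Integrable (fun r : ℝ => r ^ d) F) (hs : ∀ᵐ s ∂F, 0 ≤ s)
    {α : ℝ} (h : RV F α) {lam : ℝ} (hlam : 0 < lam) :
    Tendsto (fun r => hR d lam F r * (lam * ballVol d r)) atTop (nhds 1) := by
  have h1 := bR_asymp hmom hs
  have hB : Tendsto (ballVol d) atTop atTop := by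
    have : Tendsto (fun r : ℝ => ballVol d 1 * r ^ d) atTop atTop :=
      (tendsto_pow_atTop hd.ne').const_mul_atTop (ballVol_pos d one_pos)
    refine this.congr' ?_
    filter_upwards [eventually_ge_atTop 0] with r hr
    rw [ballVol_eq d hr]
  have hb : Tendsto (bR d F) atTop atTop := tendsto_atTop_mono (bR_lower hmom hs) hB
  have he : Tendsto (fun r => Real.exp (-(lam * bR d F r))) atTop (nhds 0) :=
    Real.tendsto_exp_neg_atTop_nhds_zero.comp (hb.const_mul_atTop hlam)
  have h2 := ((he.const_sub 1).mul (h1.inv₀ one_ne_zero))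
  simp only [sub_zero, inv_one, mul_one] at h2
  refine h2.congr' ?_
  filter_upwards [eventually_gt_atTop 0] with r hr
  have h3 := (bR_pos hmom h hr.le).ne'
  have h4 := (ballVol_pos d hr).ne'
  unfold hR
  field_simp

end withF


/-- auxiliary increasing function for part (i) -/
def phi1 (d : ℕ) (t : ℝ) : ℝ := if 1 < t then 1 - (t ^ d)⁻¹ else 0

lemma phi1_nonneg (d : ℕ) (t : ℝ) : 0 ≤ phi1 d t := by
  unfold phi1
  split_ifs with h
  · have : (t ^ d)⁻¹ ≤ 1 := inv_le_one_of_one_le₀ (one_le_pow₀ h.le)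
    linarith
  · rfl

lemma phi1_le_one (d : ℕ) (t : ℝ) : phi1 d t ≤ 1 := by
  unfold phi1
  split_ifs with h
  · have : 0 ≤ (t ^ d)⁻¹ := by positivity
    linarith
  · exact zero_le_one

lemma phi1_meas (d : ℕ) : Measurable (phi1 d) := by
  unfold phi1
  exact Measurable.ite measurableSet_Ioi (by fun_prop) (by fun_prop)

lemma phi1_int {d : ℕ} {F : Measure ℝ} [IsProbabilityMeasure F] (u : ℝ) :
    Integrable (fun s => phi1 d (s / u)) F := by
  refine (integrable_const (1:ℝ)).mono' ((phi1_meas d).comp (by fun_prop)).aestronglyMeasurable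
    (Eventually.of_forall fun r => ?_)
  rw [Real.norm_of_nonneg (phi1_nonneg d _)]
  exact phi1_le_one d _

lemma int_gamma {d : ℕ} (hd : 0 < d) {α : ℝ} (hα : (d : ℝ) < α) :
    ∫ y in Ioi (0:ℝ), (Iic 1).indicator (fun y => (1 - y) ^ (α / d)) y = d / (α + d) := by
  have hdp : (0 : ℝ) < d := by exact_mod_cast hd
  rw [setIntegral_indicator measurableSet_Iic, Ioi_inter_Iic,
    ← intervalIntegral.integral_of_le zero_le_one,
    intervalIntegral.integral_comp_sub_left (fun x => x ^ (α / d))]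
  have : 0 < α / d := by apply div_pos <;> linarith
  rw [integral_rpow (Or.inl (by linarith))]
  simp only [sub_self, sub_zero, Real.one_rpow]
  rw [Real.zero_rpow (by linarith)]
  field_simp
  simp

lemma phi1_lim {d : ℕ} (hd : 0 < d) {F : Measure ℝ} [IsProbabilityMeasure F] {α : ℝ} (h : RV F α)
    (hα : (d : ℝ) < α) :
    Tendsto (fun u => (∫ s, phi1 d (s / u) ∂F) / tailF F u) atTop (nhds (d / (α + d))) := by
  have hdp : (0 : ℝ) < d := by exact_mod_cast hd
  rw [← int_gamma hd hα]
  refine h.karamata hd hα (phi1_nonneg d) (C := 2) two_pos ?_ (fun u _ => phi1_int u) ?_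
  · intro t ht
    have h1 : 1 < t := by
      by_contra hcon
      simp [phi1, hcon] at ht
    refine ⟨by linarith, ?_⟩
    have := phi1_le_one d t
    have : 1 ≤ t ^ d := one_le_pow₀ h1.le
    linarith
  · intro y hy
    rcases lt_or_ge y 1 with hy1 | hy1
    · have h1y : 0 < 1 - y := by linarith
      have := h.upset_lim (φ := phi1 d) (y := y) (τ := (1 - y) ^ (-(1 / (d:ℝ))))
        (by positivity) ?_ ?_
      · rw [indicator_of_mem (by simpa using hy1.le)]
        rw [← Real.rpow_mul h1y.le] at this
        convert this using 2
        congr 1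
        field_simp
      all_goals
        have hτ : ((1 - y) ^ (-(1 / (d:ℝ)))) ^ d = (1 - y)⁻¹ := by
          rw [← Real.rpow_natCast, ← Real.rpow_mul h1y.le, ← Real.rpow_neg_one]
          congr 1; field_simp
        have hτ0 : 0 < (1 - y) ^ (-(1 / (d:ℝ))) := by positivity
        intro t ht
      · have hpow : (1 - y)⁻¹ < t ^ d := by
          rw [← hτ]; exact pow_lt_pow_left₀ ht hτ0.le hd.ne'
        have ht1 : 1 < t := by
          refine lt_of_le_of_lt ?_ ht
          exact Real.one_le_rpow_of_pos_of_le_one_of_nonpos h1y (by linarith) (by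
            have : 0 < 1 / (d:ℝ) := by positivity
            linarith)
        simp only [phi1, ht1, if_true]
        have : (t ^ d)⁻¹ < 1 - y := inv_lt_of_inv_lt₀ h1y hpow
        linarith
      · unfold phi1
        split_ifs with ht1
        · have hpow : t ^ d < (1 - y)⁻¹ := by
            rw [← hτ]; exact pow_lt_pow_left₀ ht (by linarith) hd.ne'
          have : 1 - y < (t ^ d)⁻¹ := (lt_inv_comm₀ h1y (by positivity)).2 hpow
          linarith
        · exact hy.le
    · have h0 : (Iic 1).indicator (fun y => (1 - y) ^ (α / d)) y = 0 := by
        rcases eq_or_lt_of_le hy1 with h1 | h1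
        · subst h1
          have : α / d ≠ 0 := by
            apply div_ne_zero <;> linarith
          simp [Real.zero_rpow this]
        · rw [indicator_of_notMem (by simpa using h1)]
      rw [h0]
      have : ∀ u, {s | y < phi1 d (s / u)} = ∅ := fun u => by
        ext s
        simpa using (phi1_le_one d _).trans hy1
      simp [this]

lemma S_lim {d : ℕ} (hd : 0 < d) {F : Measure ℝ} [IsProbabilityMeasure F] {α : ℝ} (h : RV F α)
    (hα : (d : ℝ) < α) :
    Tendsto (fun r => (r ^ d * ∫ s in Ioi r, (s ^ d)⁻¹ ∂F) / tailF F r) atTop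
      (nhds (α / (α + d))) := by
  have hdp : (0 : ℝ) < d := by exact_mod_cast hd
  have h1 := (phi1_lim hd h hα).const_sub 1
  have h2 : 1 - d / (α + d) = α / (α + d) := by
    have : α + d ≠ 0 := by linarith
    field_simp; ring
  rw [h2] at h1
  refine h1.congr' ?_
  filter_upwards [eventually_gt_atTop 0] with r hr
  have hT := (h.pos r hr).ne'
  have h3 : r ^ d * ∫ s in Ioi r, (s ^ d)⁻¹ ∂F = tailF F r - ∫ s, phi1 d (s / r) ∂F := by
    have h4 : ∫ s, phi1 d (s / r) ∂F = ∫ s in Ioi r, phi1 d (s / r) ∂F := by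
      rw [setIntegral_eq_integral_of_forall_compl_eq_zero]
      intro s hs
      have : ¬ 1 < s / r := by
        rw [lt_div_iff₀ hr, one_mul]; exact hs
      simp [phi1, this]
    have h5 : tailF F r = ∫ s in Ioi r, 1 ∂F := by simp [tailF, Measure.real]
    rw [h4, h5, ← integral_sub (integrable_const _) (phi1_int r).integrableOn,
      ← integral_const_mul]
    refine setIntegral_congr_fun measurableSet_Ioi fun s hs => ?_
    have : 1 < s / r := by
      rw [lt_div_iff₀ hr, one_mul]; exact hs
    have hs0 : 0 < s := hr.trans hs
    simp only [phi1, this, if_true]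
    rw [div_pow]
    field_simp
    ring
  rw [h3]
  field_simp

lemma hInt_lim {d : ℕ} (hd : 0 < d) {F : Measure ℝ} [IsProbabilityMeasure F] {α : ℝ} (h : RV F α)
    (hmom : Integrable (fun r : ℝ => r ^ d) F) (hs : ∀ᵐ s ∂F, 0 ≤ s)
    {lam : ℝ} (hlam : 0 < lam) :
    Tendsto (fun r => (lam * ballVol d 1 * ∫ s in Ioi r, hR d lam F s ∂F) /
      ∫ s in Ioi r, (s ^ d)⁻¹ ∂F) atTop (nhds 1) := by
  have hw := ballVol_pos d one_pos
  have hinv : ∀ r > 0, Integrable (fun s : ℝ => (s ^ d)⁻¹) (F.restrict (Ioi r)) := by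
    intro r hr
    refine (integrable_const ((r ^ d)⁻¹)).mono' (by fun_prop) ?_
    refine (ae_restrict_mem measurableSet_Ioi).mono fun s hs => ?_
    have hs : r < s := hs
    have : 0 < s := hr.trans hs
    rw [Real.norm_of_nonneg (by positivity)]
    gcongr
  have hSpos : ∀ r > 0, 0 < ∫ s in Ioi r, (s ^ d)⁻¹ ∂F := by
    intro r hr
    rw [setIntegral_pos_iff_support_of_nonneg_ae _ (hinv r hr)]
    · have : Function.support (fun s : ℝ => (s ^ d)⁻¹) ∩ Ioi r = Ioi r := by
        refine inter_eq_right.2 fun s hs => ?_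
        have : 0 < s := hr.trans hs
        simp only [Function.mem_support]; positivity
      rw [this]
      exact (ENNReal.toReal_pos_iff.1 (h.pos r hr)).1
    · refine (ae_restrict_mem measurableSet_Ioi).mono fun s hs => ?_
      have : 0 < s := hr.trans hs
      simp only [Pi.zero_apply]; positivity
  refine tendsto_order.2 ⟨fun b hb => ?_, fun b hb => ?_⟩
  · obtain ⟨b', hb1, hb2⟩ := exists_between hb
    obtain ⟨s0, hs0⟩ := eventually_atTop.1 ((hR_asymp hd hmom hs h hlam).eventually_const_lt hb2)
    filter_upwards [eventually_ge_atTop s0, eventually_gt_atTop 0] with r hr hr0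
    refine hb1.trans_le ?_
    rw [le_div_iff₀ (hSpos r hr0), ← integral_const_mul, ← integral_const_mul]
    refine setIntegral_mono_on ((hinv r hr0).const_mul _) ((hR_integrable hmom hlam).const_mul _).integrableOn
      measurableSet_Ioi fun s hs => ?_
    have hs' : r < s := hs
    have hsp : 0 < s := hr0.trans hs'
    have := hs0 s (by linarith)
    rw [ballVol_eq d hsp.le] at this
    rw [← div_eq_mul_inv, div_le_iff₀ (by positivity)]
    linarith
  · filter_upwards [eventually_gt_atTop 0] with r hr0
    refine lt_of_le_of_lt ?_ hb
    rw [div_le_one (hSpos r hr0), ← integral_const_mul]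
    refine setIntegral_mono_on ((hR_integrable hmom hlam).const_mul _).integrableOn (hinv r hr0)
      measurableSet_Ioi fun s hs' => ?_
    have hs' : r < s := hs'
    have hsp : 0 < s := hr0.trans hs'
    have := hR_le hmom h hlam hsp.le hs
    rw [ballVol_eq d hsp.le, le_div_iff₀ hlam] at this
    rw [← one_div, le_div_iff₀ (by positivity)]
    linarith

lemma part1 (d : ℕ) (hd : 0 < d) (lam : ℝ) (hlam : 0 < lam)
    (F : Measure ℝ) [IsProbabilityMeasure F] (hs : ∀ᵐ s ∂F, 0 ≤ s)
    (hmom : Integrable (fun r : ℝ => r ^ d) F)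
    (α : ℝ) (hα : (d : ℝ) < α) (h : RV F α) (ℓ : ℝ → ℝ)
    (htail : ∀ x > 0, tailF F x = ℓ x * x ^ (-α)) :
    Tendsto
      (fun r =>
        tailth lam F (hR d lam F) r /
          ((lamth lam F (hR d lam F) * ballVol d 1)⁻¹ * (α / (α + d)) * ℓ r *
            r ^ (-(α + d))))
      atTop (nhds 1) := by
  have hdp : (0 : ℝ) < d := by exact_mod_cast hd
  have hαd : 0 < α / (α + d) := by apply div_pos <;> linarith
  have h1 := ((hInt_lim hd h hmom hs hlam).mul (S_lim hd h hα)).div_const (α / (α + d))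
  rw [one_mul, div_self hαd.ne'] at h1
  refine h1.congr' ?_
  have hev : ∀ᶠ r in atTop, ∫ s in Ioi r, (s ^ d)⁻¹ ∂F ≠ 0 := by
    filter_upwards [(S_lim hd h hα).eventually_ne hαd.ne'] with r hr h0
    simp [h0] at hr
  filter_upwards [eventually_gt_atTop 0, hev] with r hr hS
  have hl := (lamth_pos hmom h hlam hs).ne'
  have hT := (h.pos r hr).ne'
  have hTe : ℓ r * r ^ (-(α + d)) = tailF F r / r ^ d := by
    rw [htail r hr, neg_add, Real.rpow_add hr, Real.rpow_neg hr.le (d:ℝ), Real.rpow_natCast]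
    ring
  have hw := (ballVol_pos d one_pos).ne'
  rw [mul_assoc _ (ℓ r), hTe]
  unfold tailth
  have h6 : α / (α + d) ≠ 0 := hαd.ne'
  generalize α / (α + d) = A at *
  generalize (∫ s in Ioi r, (s ^ d)⁻¹ ∂F) = S at *
  field_simp


/-- normalised intersection volume -/
def phi2 (d : ℕ) (t : ℝ) : ℝ := interVol d 0 t (e1 d) t

/-- normalised integral of intersection volumes -/
def NN (d : ℕ) (F : Measure ℝ) (u : ℝ) : ℝ := ∫ s, phi2 d (s / u) ∂F

/-- comparison function `u^d T(u)` -/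
def gg (d : ℕ) (F : Measure ℝ) (u : ℝ) : ℝ := u ^ d * tailF F u

lemma phi2_mono (d : ℕ) : Monotone (phi2 d) := fun _ _ h => interVol_mono d _ _ h h

lemma phi2_nonneg (d : ℕ) (t : ℝ) : 0 ≤ phi2 d t := interVol_nonneg ..

lemma phi2_zero {d : ℕ} (hd : 0 < d) (t : ℝ) (ht : t < 1 / 2) : phi2 d t = 0 := by
  apply interVol_eq_zero
  rw [dist_zero_left, norm_e1 hd]; linarith

lemma phi2_bound {d : ℕ} (hd : 0 < d) (t : ℝ) (ht : 0 < phi2 d t) :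
    0 < t ∧ phi2 d t + 1 ≤ (ballVol d 1 + 2 ^ d) * t ^ d := by
  have h1 : 1 / 2 ≤ t := by
    by_contra hcon
    rw [phi2_zero hd t (not_le.1 hcon)] at ht
    exact lt_irrefl _ ht
  refine ⟨by linarith, ?_⟩
  have h2 : phi2 d t ≤ ballVol d t := interVol_le_left ..
  rw [ballVol_eq d (by linarith)] at h2
  have h3 : 1 ≤ 2 ^ d * t ^ d := by
    rw [← mul_pow]; exact one_le_pow₀ (by linarith)
  linarith

lemma phi2_int {d : ℕ} {F : Measure ℝ} [IsProbabilityMeasure F]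
    (hmom : Integrable (fun r : ℝ => r ^ d) F) {u : ℝ} (hu : 0 < u) :
    Integrable (fun s => phi2 d (s / u)) F := by
  have h := (interVol_integrable hmom 0 (u • e1 d) 0 0).const_mul ((u ^ d)⁻¹)
  refine h.congr (Eventually.of_forall fun s => ?_)
  have h1 := interVol_scale d (e1 d) hu (s / u)
  have h2 : u * (s / u) = s := by field_simp
  rw [h2] at h1
  simp only [zero_add, h1]
  unfold phi2
  field_simp

lemma NN_lim {d : ℕ} (hd : 0 < d) {F : Measure ℝ} [IsProbabilityMeasure F] {α : ℝ} (h : RV F α)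
    (hα : (d : ℝ) < α) (hmom : Integrable (fun r : ℝ => r ^ d) F) :
    ∃ L > 0, Tendsto (fun u => NN d F u / tailF F u) atTop (nhds L) := by
  have hw := ballVol_pos d one_pos
  refine h.karamata_ex hd hα (phi2_mono d) (phi2_nonneg d) (C := ballVol d 1 + 2 ^ d) (by positivity)
    (m := 1 / 2) (by norm_num) (fun t ht => (phi2_zero hd t ht).le) (phi2_bound hd)
    (fun u hu => phi2_int hmom hu) (t0 := 1) ?_
  apply interVol_pos_mid d _ _ _ _ (ε := 1 / 2) (by norm_num)
  all_goals rw [dist_zero_left, norm_e1 hd]; norm_num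

lemma aR_lower {d : ℕ} {F : Measure ℝ} [IsProbabilityMeasure F]
    (hmom : Integrable (fun r : ℝ => r ^ d) F) {u r₁ r₂ : ℝ} (hu : 0 < u) (h1 : 0 ≤ r₁)
    (h2 : 0 ≤ r₂) : u ^ d * NN d F u ≤ aR d F u r₁ r₂ := by
  unfold NN aR
  rw [← integral_const_mul]
  refine integral_mono ((phi2_int hmom hu).const_mul _) (interVol_integrable hmom _ _ _ _) fun s => ?_
  simp only [phi2]
  rw [← interVol_scale d _ hu]
  have : u * (s / u) = s := by field_simp
  rw [this]
  exact interVol_mono d _ _ (by linarith) (by linarith)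

lemma aR_upper {d : ℕ} (hd : 0 < d) {F : Measure ℝ} [IsProbabilityMeasure F]
    (hs : ∀ᵐ s ∂F, 0 ≤ s)
    (hmom : Integrable (fun r : ℝ => r ^ d) F) {u r₁ r₂ ε : ℝ} (hu : 0 < u) (hε0 : 0 ≤ ε)
    (hε : ε < 1 / 2) (h1 : r₁ ≤ ε * u)
    (h2 : r₂ ≤ ε * u) : aR d F u r₁ r₂ ≤ u ^ d * NN d F ((1 - 2 * ε) * u) := by
  have hε' : 0 < 1 - 2 * ε := by linarith
  unfold NN aR
  rw [← integral_const_mul]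
  refine integral_mono_ae (interVol_integrable hmom _ _ _ _)
    ((phi2_int hmom (by positivity)).const_mul _) ?_
  filter_upwards [hs] with s h0
  simp only [phi2]
  rw [← interVol_scale d _ hu]
  have hk : u * (s / ((1 - 2 * ε) * u)) = s / (1 - 2 * ε) := by field_simp
  rw [hk]
  by_cases hlt : r₁ + s + (r₂ + s) < u
  · rw [interVol_eq_zero]
    · exact interVol_nonneg ..
    · rw [dist_zero_left, norm_smul, norm_e1 hd, Real.norm_of_nonneg hu.le]; linarith
  · have h3 : ε * u + s ≤ s / (1 - 2 * ε) := by
      rw [le_div_iff₀ hε']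
      have : (1 - 2 * ε) * u ≤ 2 * s := by nlinarith
      nlinarith
    exact interVol_mono d _ _ (by linarith) (by linarith)

lemma NN_lim' {d : ℕ} {F : Measure ℝ} {α L : ℝ} (h : RV F α)
    (hL : Tendsto (fun u => NN d F u / tailF F u) atTop (nhds L)) {a : ℝ} (ha : 0 < a) :
    Tendsto (fun u => NN d F (a * u) / tailF F u) atTop (nhds (L * a ^ (-α))) := by
  have h1 := (hL.comp (tendsto_id.const_mul_atTop ha)).mul (h.lim a ha)
  refine h1.congr' ?_
  filter_upwards [eventually_gt_atTop 0] with u hu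
  have := (h.pos _ (mul_pos ha hu)).ne'
  simp only [Function.comp, id]
  field_simp

lemma gg_pos {d : ℕ} {F : Measure ℝ} {α : ℝ} (h : RV F α) {u : ℝ} (hu : 0 < u) : 0 < gg d F u :=
  mul_pos (by positivity) (h.pos u hu)

lemma aR_lim {d : ℕ} (hd : 0 < d) {F : Measure ℝ} [IsProbabilityMeasure F] {α L : ℝ} (h : RV F α)
    (hs : ∀ᵐ s ∂F, 0 ≤ s) (hmom : Integrable (fun r : ℝ => r ^ d) F) (hLp : 0 < L)
    (hL : Tendsto (fun u => NN d F u / tailF F u) atTop (nhds L)) {r₁ r₂ : ℝ}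
    (h1 : 0 ≤ r₁) (h2 : 0 ≤ r₂) :
    Tendsto (fun u => aR d F u r₁ r₂ / gg d F u) atTop (nhds L) := by
  refine tendsto_order.2 ⟨fun b hb => ?_, fun b hb => ?_⟩
  · filter_upwards [hL.eventually_const_lt hb, eventually_gt_atTop 0] with u hu hup
    refine hu.trans_le ?_
    have h3 := h.pos u hup
    rw [gg, ← mul_div_mul_left (NN d F u) _ (pow_pos hup d).ne']
    gcongr
    exact aR_lower hmom hup h1 h2
  · obtain ⟨τ, h0, hlt, hb'⟩ := rpow_cont_aux one_pos α (b / L)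
      (by rw [Real.one_rpow, lt_div_iff₀ hLp, one_mul]; exact hb)
    have hb'' : L * τ ^ (-α) < b := by rwa [lt_div_iff₀ hLp, mul_comm] at hb'
    set ε := (1 - τ) / 2 with hε
    have hεp : 0 < ε := by linarith
    filter_upwards [(NN_lim' h hL h0).eventually_lt_const hb'', eventually_gt_atTop 0,
      eventually_ge_atTop (r₁ / ε), eventually_ge_atTop (r₂ / ε)] with u hu hup hu1 hu2
    refine lt_of_le_of_lt ?_ hu
    have h3 := h.pos u hup
    rw [gg, ← mul_div_mul_left (NN d F (τ * u)) _ (pow_pos hup d).ne']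
    gcongr
    have : τ = 1 - 2 * ε := by rw [hε]; ring
    rw [this]
    refine aR_upper hd hs hmom hup hεp.le (by linarith) ?_ ?_
    · rw [mul_comm]; exact (div_le_iff₀ hεp).1 hu1
    · rw [mul_comm]; exact (div_le_iff₀ hεp).1 hu2

lemma aR_bdd {d : ℕ} (hd : 0 < d) {F : Measure ℝ} [IsProbabilityMeasure F] {α L : ℝ} (h : RV F α)
    (hs : ∀ᵐ s ∂F, 0 ≤ s) (hmom : Integrable (fun r : ℝ => r ^ d) F) (hLp : 0 < L)
    (hL : Tendsto (fun u => NN d F u / tailF F u) atTop (nhds L)) :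
    ∃ C > 0, ∃ u0 > 0, ∀ u ≥ u0, ∀ r₁ r₂, r₁ ≤ u / 4 → r₂ ≤ u / 4 →
      aR d F u r₁ r₂ ≤ C * gg d F u := by
  have h1 := (NN_lim' h hL (a := 1 / 2) (by norm_num)).eventually_lt_const (lt_add_one _)
  obtain ⟨u0, hu0⟩ := eventually_atTop.1 h1
  refine ⟨L * (1 / 2) ^ (-α) + 1, by positivity, max u0 1, by positivity, fun u hu r₁ r₂ hr1 hr2 => ?_⟩
  have hup : 0 < u := lt_of_lt_of_le one_pos (le_trans (le_max_right _ _) hu)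
  have h2 := hu0 u (le_trans (le_max_left _ _) hu)
  rw [div_lt_iff₀ (h.pos u hup)] at h2
  have h3 := aR_upper (ε := 1 / 4) (r₁ := r₁) (r₂ := r₂) hd hs hmom hup (by norm_num) (by norm_num)
    (by linarith) (by linarith)
  have h4 : (1 - 2 * (1 / 4 : ℝ)) = 1 / 2 := by norm_num
  rw [h4] at h3
  refine h3.trans ?_
  unfold gg
  calc u ^ d * NN d F (1 / 2 * u) ≤ u ^ d * ((L * (1 / 2) ^ (-α) + 1) * tailF F u) := by gcongr
    _ = _ := by ring

lemma gg_zero {d : ℕ} (hd : 0 < d) {F : Measure ℝ} {α : ℝ} (h : RV F α) (hα : (d : ℝ) < α) :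
    Tendsto (gg d F) atTop (nhds 0) := by
  have hdp : (0 : ℝ) < d := by exact_mod_cast hd
  obtain ⟨β, hβ1, hβ2⟩ := exists_between hα
  obtain ⟨K, hK, u0, hu0, hp⟩ := h.potter (β := β) (by linarith) hβ2 one_pos
  have h1 : Tendsto (fun u : ℝ => (K * u0 ^ β * tailF F u0) * u ^ (-(β - d))) atTop (nhds 0) := by
    simpa using (tendsto_rpow_neg_atTop (y := β - d) (by linarith)).const_mul (K * u0 ^ β * tailF F u0)
  refine tendsto_of_tendsto_of_tendsto_of_le_of_le' tendsto_const_nhds h1 ?_ ?_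
  · filter_upwards [eventually_gt_atTop 0] with u hu using (gg_pos h hu).le
  · filter_upwards [eventually_ge_atTop u0] with u hu
    have hup : 0 < u := hu0.trans_le hu
    have h2 := hp u0 le_rfl (u / u0) (by rw [ge_iff_le, le_div_iff₀ hu0]; linarith)
    rw [div_mul_cancel₀ _ hu0.ne', Real.div_rpow hup.le hu0.le, Real.rpow_neg hu0.le] at h2
    unfold gg
    calc u ^ d * tailF F u ≤ u ^ d * (K * (u ^ (-β) / (u0 ^ β)⁻¹) * tailF F u0) := by gcongr
      _ = _ := by
        have : u ^ (-(β - d)) = u ^ (-β) * u ^ d := by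
          rw [← Real.rpow_natCast, ← Real.rpow_add hup]; congr 1; ring
        rw [this]
        field_simp

/-! ### the retention covariance -/

lemma dbl_mono {f g : ℝ → ℝ → ℝ} (hf : Continuous (Function.uncurry f))
    (hg : Continuous (Function.uncurry g))
    (hfg : ∀ w₁ ∈ Icc (0:ℝ) 1, ∀ w₂ ∈ Icc (0:ℝ) 1, f w₁ w₂ ≤ g w₁ w₂) :
    ∫ w₁ in (0:ℝ)..1, ∫ w₂ in (0:ℝ)..1, f w₁ w₂ ≤ ∫ w₁ in (0:ℝ)..1, ∫ w₂ in (0:ℝ)..1, g w₁ w₂ := by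
  have hf1 := intervalIntegral.continuous_parametric_intervalIntegral_of_continuous' (μ := volume) hf 0 1
  have hg1 := intervalIntegral.continuous_parametric_intervalIntegral_of_continuous' (μ := volume) hg 0 1
  refine intervalIntegral.integral_mono_on zero_le_one (hf1.intervalIntegrable _ _)
    (hg1.intervalIntegrable _ _) fun w₁ h₁ => ?_
  refine intervalIntegral.integral_mono_on zero_le_one ?_ ?_ fun w₂ h₂ => hfg w₁ h₁ w₂ h₂
  · exact (hf.comp (Continuous.prodMk_right w₁)).intervalIntegrable _ _
  · exact (hg.comp (Continuous.prodMk_right w₁)).intervalIntegrable _ _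

/-- limiting weight kernel -/
def GG (d : ℕ) (lam : ℝ) (F : Measure ℝ) (r₁ r₂ : ℝ) : ℝ :=
  ∫ w₁ in (0:ℝ)..1, ∫ w₂ in (0:ℝ)..1,
    Real.exp (-(lam * bR d F r₁ * (1 - w₁))) * Real.exp (-(lam * bR d F r₂ * (1 - w₂))) *
      (1 - max w₁ w₂)

lemma int_exp_eq {c : ℝ} (hc : c ≠ 0) :
    ∫ w in (0:ℝ)..1, Real.exp (-(c * (1 - w))) = (1 - Real.exp (-c)) / c := by
  have h : ∀ x ∈ uIcc (0:ℝ) 1, HasDerivAt (fun w => Real.exp (-(c * (1 - w))) / c)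
      (Real.exp (-(c * (1 - x)))) x := by
    intro x _
    have h1 : HasDerivAt (fun w : ℝ => -(c * (1 - w))) c x := by
      have h0 := ((hasDerivAt_id x).const_mul c).sub_const c
      have e : (fun w : ℝ => -(c * (1 - w))) = fun w : ℝ => c * id w - c := by
        funext w; simp only [id]; ring
      rw [e]
      exact h0.congr_deriv (mul_one c)
    have := h1.exp.div_const c
    simpa [mul_div_assoc, hc] using this
  rw [intervalIntegral.integral_eq_sub_of_hasDerivAt h
    (Continuous.intervalIntegrable (by fun_prop) _ _)]
  simp
  ring

section q
set_option linter.unusedSectionVars false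
variable {d : ℕ} {lam : ℝ} {F : Measure ℝ} [IsProbabilityMeasure F]

lemma GG_nonneg (r₁ r₂ : ℝ) : 0 ≤ GG d lam F r₁ r₂ := by
  have := dbl_mono (f := fun _ _ => 0) (g := fun w₁ w₂ =>
    Real.exp (-(lam * bR d F r₁ * (1 - w₁))) * Real.exp (-(lam * bR d F r₂ * (1 - w₂))) *
      (1 - max w₁ w₂)) (by unfold Function.uncurry; fun_prop) (by unfold Function.uncurry; fun_prop) ?_
  · unfold GG; simpa using this
  · intro w₁ h₁ w₂ h₂
    have : 0 ≤ 1 - max w₁ w₂ := by simpa using ⟨h₁.2, h₂.2⟩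
    positivity

lemma exp_fac_le_one {c w : ℝ} (hc : 0 ≤ c) (hw : w ≤ 1) : Real.exp (-(c * (1 - w))) ≤ 1 := by
  have : 0 ≤ c * (1 - w) := mul_nonneg hc (by linarith)
  exact Real.exp_le_one_iff.2 (by linarith)

lemma GG_pos (hlam : 0 < lam) (r₁ r₂ : ℝ) : 0 < GG d lam F r₁ r₂ := by
  have hb1 := bR_nonneg (d := d) (F := F) r₁
  have hb2 := bR_nonneg (d := d) (F := F) r₂
  have := dbl_mono (f := fun w₁ w₂ =>
    Real.exp (-(lam * bR d F r₁)) * Real.exp (-(lam * bR d F r₂)) *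
      ((1 - w₁) * (1 - w₂))) (g := fun w₁ w₂ =>
    Real.exp (-(lam * bR d F r₁ * (1 - w₁))) * Real.exp (-(lam * bR d F r₂ * (1 - w₂))) *
      (1 - max w₁ w₂)) (by unfold Function.uncurry; fun_prop) (by unfold Function.uncurry; fun_prop) ?_
  · refine lt_of_lt_of_le ?_ this
    have h1 : ∫ w in (0:ℝ)..1, (1 - w) = 1 / 2 := by
      rw [intervalIntegral.integral_comp_sub_left (fun x => x)]; norm_num
    simp only [intervalIntegral.integral_const_mul, intervalIntegral.integral_mul_const, h1]
    positivity
  · intro w₁ h₁ w₂ h₂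
    have a1 := h₁.1
    have a2 := h₁.2
    have a3 := h₂.1
    have a4 := h₂.2
    have n1 : 0 ≤ 1 - w₁ := by linarith
    have n2 : 0 ≤ 1 - w₂ := by linarith
    gcongr ?_ * ?_ * ?_
    · apply Real.exp_le_exp.2
      have : 0 ≤ lam * bR d F r₁ := by positivity
      nlinarith
    · apply Real.exp_le_exp.2
      have : 0 ≤ lam * bR d F r₂ := by positivity
      nlinarith
    · rcases max_cases w₁ w₂ with ⟨h, _⟩ | ⟨h, _⟩ <;> rw [h] <;> nlinarith

lemma GG_le_one (hlam : 0 < lam) (r₁ r₂ : ℝ) : GG d lam F r₁ r₂ ≤ 1 := by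
  have hb1 := bR_nonneg (d := d) (F := F) r₁
  have hb2 := bR_nonneg (d := d) (F := F) r₂
  have := dbl_mono (g := fun _ _ => 1) (f := fun w₁ w₂ =>
    Real.exp (-(lam * bR d F r₁ * (1 - w₁))) * Real.exp (-(lam * bR d F r₂ * (1 - w₂))) *
      (1 - max w₁ w₂)) (by unfold Function.uncurry; fun_prop) (by unfold Function.uncurry; fun_prop) ?_
  · unfold GG; simpa using this
  · intro w₁ h₁ w₂ h₂
    have h0 : 0 ≤ 1 - max w₁ w₂ := by simpa using ⟨h₁.2, h₂.2⟩
    have h3 : 1 - max w₁ w₂ ≤ 1 := by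
      have := le_max_left w₁ w₂
      linarith [h₁.1]
    have e1 := exp_fac_le_one (c := lam * bR d F r₁) (by positivity) h₁.2
    have e2 := exp_fac_le_one (c := lam * bR d F r₂) (by positivity) h₂.2
    calc _ ≤ (1:ℝ) * 1 * 1 := by gcongr
      _ = 1 := by norm_num

lemma qR_lower (_hlam : 0 < lam) {u r₁ r₂ : ℝ} (hu : r₁ + r₂ < u) :
    lam * aR d F u r₁ r₂ * GG d lam F r₁ r₂ ≤ qR d lam F u r₁ r₂ := by
  unfold GG qR
  simp only [hu, if_true]
  rw [← intervalIntegral.integral_const_mul]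
  simp_rw [← intervalIntegral.integral_const_mul]
  refine dbl_mono (by unfold Function.uncurry; fun_prop) (by unfold Function.uncurry; fun_prop) ?_
  intro w₁ h₁ w₂ h₂
  have := Real.add_one_le_exp (lam * (1 - max w₁ w₂) * aR d F u r₁ r₂)
  calc _ = Real.exp (-(lam * bR d F r₁ * (1 - w₁))) * Real.exp (-(lam * bR d F r₂ * (1 - w₂))) *
      (lam * (1 - max w₁ w₂) * aR d F u r₁ r₂) := by ring
    _ ≤ _ := by gcongr; linarith

lemma qR_upper (hlam : 0 < lam) {u r₁ r₂ : ℝ} (hu : r₁ + r₂ < u) :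
    qR d lam F u r₁ r₂ ≤
      lam * aR d F u r₁ r₂ * Real.exp (lam * aR d F u r₁ r₂) * GG d lam F r₁ r₂ := by
  have ha := aR_nonneg (d := d) (F := F) u r₁ r₂
  unfold GG qR
  simp only [hu, if_true]
  rw [← intervalIntegral.integral_const_mul]
  simp_rw [← intervalIntegral.integral_const_mul]
  refine dbl_mono (by unfold Function.uncurry; fun_prop) (by unfold Function.uncurry; fun_prop) ?_
  intro w₁ h₁ w₂ h₂
  have h0 : 0 ≤ 1 - max w₁ w₂ := by simpa using ⟨h₁.2, h₂.2⟩
  have h3 : 1 - max w₁ w₂ ≤ 1 := by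
    have := le_max_left w₁ w₂
    linarith [h₁.1]
  set x := lam * (1 - max w₁ w₂) * aR d F u r₁ r₂ with hx
  have hx0 : 0 ≤ x := by positivity
  have hxa : x ≤ lam * aR d F u r₁ r₂ := by
    have : lam * (1 - max w₁ w₂) ≤ lam := by nlinarith
    exact mul_le_mul_of_nonneg_right this ha
  have h4 : Real.exp x - 1 ≤ x * Real.exp x := by
    have h5 := Real.add_one_le_exp (-x)
    have h6 : Real.exp x * Real.exp (-x) = 1 := by rw [← Real.exp_add]; simp
    nlinarith [Real.exp_pos x]
  calc _ ≤ Real.exp (-(lam * bR d F r₁ * (1 - w₁))) * Real.exp (-(lam * bR d F r₂ * (1 - w₂))) *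
      (x * Real.exp (lam * aR d F u r₁ r₂)) := by
        gcongr
        exact h4.trans (by gcongr)
    _ = _ := by rw [hx]; ring

lemma qR_abs_le (hlam : 0 < lam) (hmom : Integrable (fun r : ℝ => r ^ d) F) (u r₁ r₂ : ℝ) :
    |qR d lam F u r₁ r₂| ≤ ∫ w in (0:ℝ)..1, Real.exp (-(lam * bR d F r₁ * (1 - w))) ∧
    |qR d lam F u r₁ r₂| ≤ ∫ w in (0:ℝ)..1, Real.exp (-(lam * bR d F r₂ * (1 - w))) ∧
    |qR d lam F u r₁ r₂| ≤ 1 := by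
  have ha := aR_nonneg (d := d) (F := F) u r₁ r₂
  have ha1 := aR_le_left hmom u r₁ r₂
  have ha2 := aR_le_right hmom u r₁ r₂
  have hb1 := bR_nonneg (d := d) (F := F) r₁
  have hb2 := bR_nonneg (d := d) (F := F) r₂
  have hX : ∃ X : ℝ → ℝ → ℝ, Continuous (Function.uncurry X) ∧
      (∀ w₁ w₂, (if r₁ + r₂ < u then Real.exp (lam * (1 - max w₁ w₂) * aR d F u r₁ r₂) else 0) = X w₁ w₂) ∧
      (∀ w₁ w₂, 0 ≤ X w₁ w₂ ∧ X w₁ w₂ ≤ Real.exp (lam * (1 - max w₁ w₂) * aR d F u r₁ r₂)) := by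
    by_cases hu : r₁ + r₂ < u
    · refine ⟨fun w₁ w₂ => Real.exp (lam * (1 - max w₁ w₂) * aR d F u r₁ r₂),
        by unfold Function.uncurry; fun_prop, by simp [hu], fun _ _ => ⟨by positivity, le_rfl⟩⟩
    · exact ⟨fun _ _ => 0, by unfold Function.uncurry; fun_prop, by simp [hu],
        fun _ _ => ⟨le_rfl, by positivity⟩⟩
  obtain ⟨X, hXc, hXe, hXb⟩ := hX
  have hq : qR d lam F u r₁ r₂ = ∫ w₁ in (0:ℝ)..1, ∫ w₂ in (0:ℝ)..1,
    Real.exp (-(lam * bR d F r₁ * (1 - w₁))) * Real.exp (-(lam * bR d F r₂ * (1 - w₂))) *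
      (X w₁ w₂ - 1) := by
    unfold qR; simp only [hXe]
  have hc : Continuous (Function.uncurry fun w₁ w₂ : ℝ =>
      Real.exp (-(lam * bR d F r₁ * (1 - w₁))) * Real.exp (-(lam * bR d F r₂ * (1 - w₂))) *
      (X w₁ w₂ - 1)) := by
    unfold Function.uncurry at hXc ⊢
    fun_prop
  have key : ∀ K : ℝ → ℝ → ℝ, Continuous (Function.uncurry K) →
      (∀ w₁ ∈ Icc (0:ℝ) 1, ∀ w₂ ∈ Icc (0:ℝ) 1,
        min (Real.exp (-(lam * bR d F r₁ * (1 - w₁)))) (Real.exp (-(lam * bR d F r₂ * (1 - w₂))))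
          ≤ K w₁ w₂) →
      |qR d lam F u r₁ r₂| ≤ ∫ w₁ in (0:ℝ)..1, ∫ w₂ in (0:ℝ)..1, K w₁ w₂ := by
    intro K hK hKb
    have hpt : ∀ w₁ ∈ Icc (0:ℝ) 1, ∀ w₂ ∈ Icc (0:ℝ) 1,
        |Real.exp (-(lam * bR d F r₁ * (1 - w₁))) * Real.exp (-(lam * bR d F r₂ * (1 - w₂))) *
      (X w₁ w₂ - 1)| ≤ K w₁ w₂ := by
      intro w₁ h₁ w₂ h₂
      refine le_trans ?_ (hKb w₁ h₁ w₂ h₂)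
      have e1 := exp_fac_le_one (c := lam * bR d F r₁) (by positivity) h₁.2
      have e2 := exp_fac_le_one (c := lam * bR d F r₂) (by positivity) h₂.2
      have h0 : 0 ≤ 1 - max w₁ w₂ := by simpa using ⟨h₁.2, h₂.2⟩
      have x1 : Real.exp (-(lam * bR d F r₁ * (1 - w₁))) * X w₁ w₂ ≤ 1 := by
        calc _ ≤ Real.exp (-(lam * bR d F r₁ * (1 - w₁))) *
              Real.exp (lam * (1 - max w₁ w₂) * aR d F u r₁ r₂) := by gcongr; exact (hXb _ _).2
          _ ≤ 1 := by
              rw [← Real.exp_add, Real.exp_le_one_iff]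
              have : (1 - max w₁ w₂) * aR d F u r₁ r₂ ≤ (1 - w₁) * bR d F r₁ := by
                have := le_max_left w₁ w₂
                gcongr
                linarith [h₁.2]
              nlinarith
      have x2 : Real.exp (-(lam * bR d F r₂ * (1 - w₂))) * X w₁ w₂ ≤ 1 := by
        calc _ ≤ Real.exp (-(lam * bR d F r₂ * (1 - w₂))) *
              Real.exp (lam * (1 - max w₁ w₂) * aR d F u r₁ r₂) := by gcongr; exact (hXb _ _).2
          _ ≤ 1 := by
              rw [← Real.exp_add, Real.exp_le_one_iff]
              have : (1 - max w₁ w₂) * aR d F u r₁ r₂ ≤ (1 - w₂) * bR d F r₂ := by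
                have := le_max_right w₁ w₂
                gcongr
                linarith [h₂.2]
              nlinarith
      have x0 := (hXb w₁ w₂).1
      have p1 := Real.exp_pos (-(lam * bR d F r₁ * (1 - w₁)))
      have p2 := Real.exp_pos (-(lam * bR d F r₂ * (1 - w₂)))
      generalize Real.exp (-(lam * bR d F r₁ * (1 - w₁))) = E1 at *
      generalize Real.exp (-(lam * bR d F r₂ * (1 - w₂))) = E2 at *
      generalize X w₁ w₂ = x at *
      have y1 := mul_le_mul_of_nonneg_left x1 p2.le
      have y2 := mul_le_mul_of_nonneg_left x2 p1.le
      have z1 : E1 * E2 ≤ E1 := by nlinarith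
      have z2 : E1 * E2 ≤ E2 := by nlinarith
      have z3 : 0 ≤ E1 * E2 * x := by positivity
      have z4 : 0 ≤ E1 * E2 := by positivity
      rw [le_min_iff, abs_le, abs_le]
      refine ⟨⟨?_, ?_⟩, ?_, ?_⟩ <;> nlinarith
    rw [abs_le, hq]
    constructor
    · have := dbl_mono (f := fun w₁ w₂ => - K w₁ w₂) (by unfold Function.uncurry at hK ⊢; fun_prop) hc
        fun w₁ h₁ w₂ h₂ => (abs_le.1 (hpt w₁ h₁ w₂ h₂)).1
      simpa using this
    · exact dbl_mono hc hK fun w₁ h₁ w₂ h₂ => (abs_le.1 (hpt w₁ h₁ w₂ h₂)).2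
  refine ⟨?_, ?_, ?_⟩
  · have := key (fun w₁ _ => Real.exp (-(lam * bR d F r₁ * (1 - w₁))))
      (by unfold Function.uncurry; fun_prop) fun _ _ _ _ => min_le_left _ _
    simpa using this
  · have := key (fun _ w₂ => Real.exp (-(lam * bR d F r₂ * (1 - w₂))))
      (by unfold Function.uncurry; fun_prop) fun _ _ _ _ => min_le_right _ _
    simpa using this
  · have := key (fun _ _ => 1)
      (by unfold Function.uncurry; fun_prop) fun w₁ h₁ _ _ => (min_le_left _ _).trans
        (exp_fac_le_one (c := lam * bR d F r₁) (by positivity) h₁.2)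
    simpa using this

lemma qR_le_h (hlam : 0 < lam) (hmom : Integrable (fun r : ℝ => r ^ d) F) {α : ℝ} (h : RV F α)
    (u : ℝ) {r₁ r₂ : ℝ} (h1 : 0 ≤ r₁) (h2 : 0 ≤ r₂) :
    |qR d lam F u r₁ r₂| ≤ hR d lam F r₁ ∧ |qR d lam F u r₁ r₂| ≤ hR d lam F r₂ := by
  have b1 := bR_pos hmom h h1
  have b2 := bR_pos hmom h h2
  obtain ⟨q1, q2, _⟩ := qR_abs_le hlam hmom u r₁ r₂
  rw [int_exp_eq (by positivity)] at q1 q2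
  exact ⟨q1, q2⟩

lemma qR_measurable (hmom : Integrable (fun r : ℝ => r ^ d) F) :
    Measurable (fun p : ℝ × ℝ × ℝ => qR d lam F p.1 p.2.1 p.2.2) := by
  unfold qR
  simp only [intervalIntegral.integral_of_le (zero_le_one' ℝ)]
  have hb := (bR_mono hmom).measurable
  have ha := aR_measurable (d := d) (F := F)
  refine StronglyMeasurable.measurable ?_
  refine StronglyMeasurable.integral_prod_right ?_
  unfold Function.uncurry
  refine StronglyMeasurable.integral_prod_right ?_
  refine Measurable.stronglyMeasurable ?_
  unfold Function.uncurry
  have ha' : Measurable fun p : ((ℝ × ℝ × ℝ) × ℝ) × ℝ => aR d F p.1.1.1 p.1.1.2.1 p.1.1.2.2 :=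
    ha.comp (by fun_prop)
  refine Measurable.mul (by fun_prop) (Measurable.sub ?_ measurable_const)
  exact Measurable.ite (measurableSet_lt (by fun_prop) (by fun_prop)) (by fun_prop) measurable_const

lemma GG_measurable (hmom : Integrable (fun r : ℝ => r ^ d) F) :
    Measurable (fun p : ℝ × ℝ => GG d lam F p.1 p.2) := by
  unfold GG
  simp only [intervalIntegral.integral_of_le (zero_le_one' ℝ)]
  have hb := (bR_mono hmom).measurable
  refine StronglyMeasurable.measurable ?_
  refine StronglyMeasurable.integral_prod_right ?_
  unfold Function.uncurry
  refine StronglyMeasurable.integral_prod_right ?_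
  refine Measurable.stronglyMeasurable ?_
  unfold Function.uncurry
  fun_prop

lemma qR_lim (hd : 0 < d) (hlam : 0 < lam) {α L : ℝ} (h : RV F α) (hα : (d : ℝ) < α)
    (hs : ∀ᵐ s ∂F, 0 ≤ s) (hmom : Integrable (fun r : ℝ => r ^ d) F) (hLp : 0 < L)
    (hL : Tendsto (fun u => NN d F u / tailF F u) atTop (nhds L)) {r₁ r₂ : ℝ}
    (h1 : 0 ≤ r₁) (h2 : 0 ≤ r₂) :
    Tendsto (fun u => qR d lam F u r₁ r₂ / gg d F u) atTop (nhds (lam * L * GG d lam F r₁ r₂)) := by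
  have ha := aR_lim hd h hs hmom hLp hL h1 h2
  have ha0 : Tendsto (fun u => aR d F u r₁ r₂) atTop (nhds 0) := by
    have := ha.mul (gg_zero hd h hα)
    rw [mul_zero] at this
    refine this.congr' ?_
    filter_upwards [eventually_gt_atTop 0] with u hu
    exact div_mul_cancel₀ _ (gg_pos h hu).ne'
  have he : Tendsto (fun u => Real.exp (lam * aR d F u r₁ r₂)) atTop (nhds 1) := by
    have := (Real.continuous_exp.tendsto 0).comp (by simpa using ha0.const_mul lam :
      Tendsto (fun u => lam * aR d F u r₁ r₂) atTop (nhds 0))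
    simpa [Function.comp_def] using this
  have lo := (ha.const_mul lam).mul_const (GG d lam F r₁ r₂)
  have up := ((ha.const_mul lam).mul he).mul_const (GG d lam F r₁ r₂)
  rw [mul_one] at up
  refine tendsto_of_tendsto_of_tendsto_of_le_of_le' lo up ?_ ?_
  · filter_upwards [eventually_gt_atTop 0, eventually_gt_atTop (r₁ + r₂)] with u hu hr
    rw [le_div_iff₀ (gg_pos h hu)]
    refine le_trans (le_of_eq ?_) (qR_lower hlam hr)
    have := (gg_pos (d := d) h hu).ne'
    field_simp
  · filter_upwards [eventually_gt_atTop 0, eventually_gt_atTop (r₁ + r₂)] with u hu hr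
    rw [div_le_iff₀ (gg_pos h hu)]
    refine le_trans (qR_upper hlam hr) (le_of_eq ?_)
    have := (gg_pos (d := d) h hu).ne'
    field_simp

lemma qR_bdd (hd : 0 < d) (hlam : 0 < lam) {α L : ℝ} (h : RV F α) (hα : (d : ℝ) < α)
    (hs : ∀ᵐ s ∂F, 0 ≤ s) (hmom : Integrable (fun r : ℝ => r ^ d) F) (hLp : 0 < L)
    (hL : Tendsto (fun u => NN d F u / tailF F u) atTop (nhds L)) :
    ∃ C > 0, ∃ u0 > 0, ∀ u ≥ u0, ∀ r₁ r₂, 0 ≤ r₁ → 0 ≤ r₂ → r₁ ≤ u / 4 → r₂ ≤ u / 4 →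
      |qR d lam F u r₁ r₂| ≤ C * gg d F u := by
  obtain ⟨C, hC, u0, hu0, hb⟩ := aR_bdd hd h hs hmom hLp hL
  obtain ⟨u1, hu1⟩ := eventually_atTop.1 ((gg_zero hd h hα).eventually_lt_const one_pos)
  refine ⟨lam * C * Real.exp (lam * C), by positivity, max u0 u1, lt_max_of_lt_left hu0, ?_⟩
  intro u hu r₁ r₂ hr1 hr2 hr1' hr2'
  have hua : u0 ≤ u := (le_max_left _ _).trans hu
  have hub : u1 ≤ u := (le_max_right _ _).trans hu
  have hup : 0 < u := hu0.trans_le hua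
  have hg := gg_pos (d := d) h hup
  have hg1 := hu1 u hub
  have hlt : r₁ + r₂ < u := by linarith
  have ha := aR_nonneg (d := d) (F := F) u r₁ r₂
  have hab := hb u hua r₁ r₂ hr1' hr2'
  have h0 : 0 ≤ qR d lam F u r₁ r₂ := by
    refine le_trans ?_ (qR_lower hlam hlt)
    have := GG_nonneg (d := d) (lam := lam) (F := F) r₁ r₂
    positivity
  rw [abs_of_nonneg h0]
  refine (qR_upper hlam hlt).trans ?_
  have hG := GG_le_one (d := d) (F := F) hlam r₁ r₂
  have hG0 := GG_nonneg (d := d) (lam := lam) (F := F) r₁ r₂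
  have haC : aR d F u r₁ r₂ ≤ C := by nlinarith
  calc _ ≤ lam * (C * gg d F u) * Real.exp (lam * C) * 1 := by gcongr
    _ = _ := by ring

end q


section final
set_option linter.unusedSectionVars false
variable {d : ℕ} {lam : ℝ} {F : Measure ℝ} [IsProbabilityMeasure F]

lemma tail_neg (hd : 0 < d) {α : ℝ} (h : RV F α) :
    Tendsto (fun v => tailF F (v / 16) / gg d F v) atTop (nhds 0) := by
  have h1 := (h.lim (1 / 16) (by norm_num)).mul
    (tendsto_inv_atTop_zero.comp (tendsto_pow_atTop (α := ℝ) hd.ne'))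
  rw [mul_zero] at h1
  refine h1.congr fun v => ?_
  have : 1 / 16 * v = v / 16 := by ring
  simp only [Function.comp, gg, this]
  rw [div_mul_eq_div_div_swap, div_eq_mul_inv (_ / _) (v ^ d)]

lemma generic {X : Type*} [MeasurableSpace X] {μ : Measure X} {W R1 R2 : X → ℝ} {U : Euc d → X → ℝ}
    (hd : 0 < d) (hlam : 0 < lam) {α L : ℝ} (h : RV F α) (hα : (d : ℝ) < α)
    (hs : ∀ᵐ s ∂F, 0 ≤ s) (hmom : Integrable (fun r : ℝ => r ^ d) F) (hLp : 0 < L)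
    (hL : Tendsto (fun u => NN d F u / tailF F u) atTop (nhds L))
    (hW : Integrable W μ) (hW0 : ∀ p, 0 ≤ W p) (hR1m : Measurable R1) (hR2m : Measurable R2)
    (hR : ∀ᵐ p ∂μ, 0 ≤ R1 p ∧ 0 ≤ R2 p) (hUm : ∀ z, Measurable (U z))
    (hU : ∀ z p, W p ≠ 0 → 0 ≤ R1 p → 0 ≤ R2 p → |U z p - ‖z‖| ≤ R1 p + R2 p) {K : ℝ}
    (hbad : ∀ z : Euc d, 0 < ‖z‖ → ∫ p in {p | ‖z‖ / 16 < R1 p ∨ ‖z‖ / 16 < R2 p},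
      W p * |qR d lam F (U z p) (R1 p) (R2 p)| ∂μ ≤ K * tailF F (‖z‖ / 16)) :
    Tendsto (fun z => (∫ p, W p * qR d lam F (U z p) (R1 p) (R2 p) ∂μ) / gg d F ‖z‖)
      (comap norm atTop) (nhds (lam * L * ∫ p, W p * GG d lam F (R1 p) (R2 p) ∂μ)) := by
  have hn : Tendsto (fun z : Euc d => ‖z‖) (comap norm atTop) atTop := tendsto_comap
  have hqm : ∀ z, Measurable fun p => qR d lam F (U z p) (R1 p) (R2 p) := fun z =>
    (qR_measurable hmom).comp (f := fun p => (U z p, R1 p, R2 p))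
      ((hUm z).prodMk (hR1m.prodMk hR2m))
  have hWq : ∀ z, Integrable (fun p => W p * qR d lam F (U z p) (R1 p) (R2 p)) μ := by
    intro z
    refine hW.mono' (hW.aestronglyMeasurable.mul (hqm z).aestronglyMeasurable)
      (Eventually.of_forall fun p => ?_)
    have h1 := (qR_abs_le hlam hmom (U z p) (R1 p) (R2 p)).2.2
    rw [norm_mul, Real.norm_of_nonneg (hW0 p), Real.norm_eq_abs]
    exact mul_le_of_le_one_right (hW0 p) h1
  set bad : Euc d → Set X := fun z => {p | ‖z‖ / 16 < R1 p ∨ ‖z‖ / 16 < R2 p} with hbd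
  have hbm : ∀ z, MeasurableSet (bad z) := fun z =>
    (measurableSet_lt measurable_const hR1m).union (measurableSet_lt measurable_const hR2m)
  -- bad part
  have hB : Tendsto (fun z => (∫ p in bad z, W p * qR d lam F (U z p) (R1 p) (R2 p) ∂μ) / gg d F ‖z‖)
      (comap norm atTop) (nhds 0) := by
    have h0 := ((tail_neg hd h).comp hn).const_mul K
    rw [mul_zero] at h0
    refine squeeze_zero_norm' ?_ h0
    filter_upwards [hn.eventually (eventually_gt_atTop 0)] with z hz
    have hg := gg_pos (d := d) h hz
    rw [norm_div, Real.norm_of_nonneg hg.le, Function.comp, ← mul_div_assoc]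
    gcongr
    refine (norm_integral_le_integral_norm _).trans (le_trans (le_of_eq ?_) (hbad z hz))
    refine integral_congr_ae (Eventually.of_forall fun p => ?_)
    simp only [norm_mul, Real.norm_of_nonneg (hW0 p), Real.norm_eq_abs]
  -- good part
  have hG : Tendsto (fun z => ∫ p, (bad z)ᶜ.indicator
        (fun p => W p * qR d lam F (U z p) (R1 p) (R2 p) / gg d F ‖z‖) p ∂μ)
      (comap norm atTop) (nhds (∫ p, lam * L * (W p * GG d lam F (R1 p) (R2 p)) ∂μ)) := by
    obtain ⟨C, hC, u0, hu0, hqb⟩ := qR_bdd hd hlam h hα hs hmom hLp hL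
    obtain ⟨K2, hK2, u2, hu2, hTb⟩ := h.bdd (a := 1 / 2) (by norm_num)
    refine tendsto_integral_filter_of_dominated_convergence
      (fun p => (C * (2 ^ d * K2)) * W p) ?_ ?_ (hW.const_mul _) ?_
    · refine Eventually.of_forall fun z => ?_
      exact ((hWq z).div_const _).aestronglyMeasurable.indicator (hbm z).compl
    · filter_upwards [hn.eventually (eventually_gt_atTop 0),
        hn.eventually (eventually_ge_atTop (2 * u0)), hn.eventually (eventually_ge_atTop u2)]
        with z hz hz1 hz2
      filter_upwards [hR] with p hp
      have hWp := hW0 p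
      by_cases hpb : p ∈ (bad z)ᶜ
      swap
      · rw [indicator_of_notMem hpb, norm_zero]; positivity
      rw [indicator_of_mem hpb]
      by_cases hWz : W p = 0
      · simp [hWz]
      have hUz := abs_le.1 (hU z p hWz hp.1 hp.2)
      simp only [hbd, mem_compl_iff, mem_ofPred_eq, not_or, not_lt] at hpb
      have hg := gg_pos (d := d) h hz
      have hq := hqb (U z p) (by linarith) (R1 p) (R2 p) hp.1 hp.2 (by linarith) (by linarith)
      have hgU : gg d F (U z p) ≤ (2 ^ d * K2) * gg d F ‖z‖ := by
        unfold gg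
        have hT := (h.pos _ hz).le
        have hTU := (h.pos (U z p) (by linarith)).le
        calc U z p ^ d * tailF F (U z p) ≤ (2 * ‖z‖) ^ d * (K2 * tailF F ‖z‖) := by
              gcongr
              · linarith
              · linarith
              · exact (h.anti (by linarith)).trans (hTb _ hz2)
          _ = _ := by rw [mul_pow]; ring
      rw [norm_div, norm_mul, Real.norm_of_nonneg hWp, Real.norm_of_nonneg hg.le, Real.norm_eq_abs,
        div_le_iff₀ hg]
      calc W p * |qR d lam F (U z p) (R1 p) (R2 p)| ≤ W p * (C * ((2 ^ d * K2) * gg d F ‖z‖)) := by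
            gcongr
            exact hq.trans (by gcongr)
        _ = _ := by ring
    · filter_upwards [hR] with p hp
      by_cases hWz : W p = 0
      · have e : ∀ z, (bad z)ᶜ.indicator
            (fun p => W p * qR d lam F (U z p) (R1 p) (R2 p) / gg d F ‖z‖) p = 0 := by
          intro z
          by_cases hpb : p ∈ (bad z)ᶜ
          · rw [indicator_of_mem hpb]; simp [hWz]
          · rw [indicator_of_notMem hpb]
        simp only [e]
        rw [hWz, zero_mul, mul_zero]
        exact tendsto_const_nhds
      have hUe : ∀ z, |U z p - ‖z‖| ≤ R1 p + R2 p := fun z => hU z p hWz hp.1 hp.2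
      have hUt : Tendsto (fun z => U z p) (comap norm atTop) atTop := by
        refine tendsto_atTop_mono (fun z => ?_) (tendsto_atTop_add_const_right _ (-(R1 p + R2 p)) hn)
        have := (abs_le.1 (hUe z)).1
        linarith
      have hUr : Tendsto (fun z => U z p / ‖z‖) (comap norm atTop) (nhds 1) := by
        have h1 : Tendsto (fun z : Euc d => (R1 p + R2 p) * ‖z‖⁻¹) (comap norm atTop) (nhds 0) := by
          simpa using (tendsto_inv_atTop_zero.comp hn).const_mul (R1 p + R2 p)
        have h2 : Tendsto (fun z : Euc d => U z p / ‖z‖ - 1) (comap norm atTop) (nhds 0) := by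
          refine squeeze_zero_norm' ?_ h1
          filter_upwards [hn.eventually (eventually_gt_atTop 0)] with z hz
          have : U z p / ‖z‖ - 1 = (U z p - ‖z‖) * ‖z‖⁻¹ := by field_simp
          rw [this, norm_mul, norm_inv, norm_norm, Real.norm_eq_abs]
          gcongr
          exact hUe z
        simpa using h2.add_const 1
      have hgr : Tendsto (fun z => gg d F (U z p) / gg d F ‖z‖) (comap norm atTop) (nhds 1) := by
        have := (hUr.pow d).mul (h.equiv hn hUr)
        rw [one_pow, mul_one] at this
        refine this.congr fun z => ?_
        unfold gg
        rw [div_pow, div_mul_div_comm]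
      have hq := ((qR_lim hd hlam h hα hs hmom hLp hL hp.1 hp.2).comp hUt).mul hgr
      have hq' := hq.const_mul (W p)
      rw [mul_one] at hq'
      have e : W p * (lam * L * GG d lam F (R1 p) (R2 p)) = lam * L * (W p * GG d lam F (R1 p) (R2 p)) := by
        ring
      rw [e] at hq'
      refine hq'.congr' ?_
      filter_upwards [hUt.eventually (eventually_gt_atTop 0),
        hn.eventually (eventually_ge_atTop (16 * R1 p)),
        hn.eventually (eventually_ge_atTop (16 * R2 p))] with z hz hz1 hz2
      have hpb : p ∈ (bad z)ᶜ := by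
        simp only [hbd, mem_compl_iff, mem_ofPred_eq, not_or, not_lt]
        constructor <;> linarith
      rw [indicator_of_mem hpb]
      have := (gg_pos (d := d) h hz).ne'
      simp only [Function.comp]
      field_simp
  rw [integral_const_mul] at hG
  have := hB.add hG
  rw [zero_add] at this
  refine this.congr fun z => ?_
  rw [integral_indicator (hbm z).compl, integral_div, ← add_div,
    integral_add_compl (hbm z) (hWq z)]

lemma part3 (hd : 0 < d) (hlam : 0 < lam) {α L : ℝ} (h : RV F α) (hα : (d : ℝ) < α)
    (hs : ∀ᵐ s ∂F, 0 ≤ s) (hmom : Integrable (fun r : ℝ => r ^ d) F) (hLp : 0 < L)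
    (hL : Tendsto (fun u => NN d F u / tailF F u) atTop (nhds L)) :
    ∃ c > 0, Tendsto (fun z => xith d lam F (hR d lam F) (qR d lam F) z / gg d F ‖z‖)
      (comap norm atTop) (nhds c) := by
  have hRR : ∀ᵐ p ∂(F.prod F), 0 ≤ p.1 ∧ 0 ≤ p.2 := by
    have h1 : ∀ᵐ p ∂(F.prod F), 0 ≤ p.1 := Measure.quasiMeasurePreserving_fst.ae hs
    have h2 : ∀ᵐ p ∂(F.prod F), 0 ≤ p.2 := Measure.quasiMeasurePreserving_snd.ae hs
    exact h1.and h2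
  have hg := generic (μ := F.prod F) (W := fun _ => 1) (R1 := Prod.fst) (R2 := Prod.snd)
    (U := fun (z : Euc d) _ => ‖z‖ ) (K := 2) hd hlam h hα hs hmom hLp hL (integrable_const _)
    (fun _ => zero_le_one) measurable_fst measurable_snd hRR (fun _ => measurable_const) ?_ ?_
  rotate_left
  · intro z p _ h1 h2
    simp only [sub_self, abs_zero]
    exact add_nonneg h1 h2
  · intro z hz
    set v := ‖z‖ / 16
    have hb : MeasurableSet {p : ℝ × ℝ | v < p.1 ∨ v < p.2} :=
      (measurableSet_lt measurable_const measurable_fst).union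
        (measurableSet_lt measurable_const measurable_snd)
    calc ∫ p in {p : ℝ × ℝ | v < p.1 ∨ v < p.2}, 1 * |qR d lam F ‖z‖ p.1 p.2| ∂(F.prod F)
        ≤ ∫ p in {p : ℝ × ℝ | v < p.1 ∨ v < p.2}, 1 ∂(F.prod F) := by
          refine integral_mono_of_nonneg (Eventually.of_forall fun p => by positivity)
            (integrable_const _) (Eventually.of_forall fun p => ?_)
          simp only [one_mul]
          exact (qR_abs_le hlam hmom _ _ _).2.2
      _ = (F.prod F).real {p : ℝ × ℝ | v < p.1 ∨ v < p.2} := by simp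
      _ ≤ (F.prod F).real (Ioi v ×ˢ univ ∪ univ ×ˢ Ioi v) := by
          refine measureReal_mono ?_
          rintro p (hp | hp)
          · left; exact ⟨hp, mem_univ _⟩
          · right; exact ⟨mem_univ _, hp⟩
      _ ≤ (F.prod F).real (Ioi v ×ˢ univ) + (F.prod F).real (univ ×ˢ Ioi v) :=
          measureReal_union_le _ _
      _ = 2 * tailF F v := by
          rw [measureReal_prod_prod, measureReal_prod_prod]
          simp only [probReal_univ]; simp only [tailF, Measure.real]; ring
  have hl := lamth_pos hmom h hlam hs
  have hGpos : 0 < ∫ p, 1 * GG d lam F p.1 p.2 ∂(F.prod F) := by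
    simp only [one_mul]
    have hGi : Integrable (fun p : ℝ × ℝ => GG d lam F p.1 p.2) (F.prod F) := by
      refine (integrable_const (1:ℝ)).mono' (GG_measurable hmom).aestronglyMeasurable
        (Eventually.of_forall fun p => ?_)
      rw [Real.norm_of_nonneg (GG_nonneg _ _)]
      exact GG_le_one hlam _ _
    rw [integral_pos_iff_support_of_nonneg (fun p => GG_nonneg _ _) hGi]
    have : Function.support (fun p : ℝ × ℝ => GG d lam F p.1 p.2) = univ :=
      eq_univ_of_forall fun p => (GG_pos hlam _ _).ne'
    rw [this]; simp
  have := hg.const_mul ((lam / lamth lam F (hR d lam F)) ^ 2)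
  refine ⟨_, ?_, this.congr fun z => ?_⟩
  · positivity
  · unfold xith
    rw [integral_prod]
    · simp only [one_mul]; ring
    · refine (integrable_const (1:ℝ)).mono' ?_ (Eventually.of_forall fun p => ?_)
      · exact ((((qR_measurable hmom).comp (f := fun p : ℝ × ℝ => (‖z‖, p.1, p.2))
          (by fun_prop))).const_mul 1).aestronglyMeasurable
      · rw [one_mul]; exact (qR_abs_le hlam hmom _ _ _).2.2

end final


section final2
set_option linter.unusedSectionVars false
variable {d : ℕ} {lam : ℝ} {F : Measure ℝ} [IsProbabilityMeasure F]

lemma interVol_lint (d : ℕ) (r₁ r₂ : ℝ) :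
    ∫⁻ x : Euc d, volume (closedBall (0 : Euc d) r₁ ∩ closedBall x r₂) =
      volume (closedBall (0 : Euc d) r₁) * volume (closedBall (0 : Euc d) r₂) := by
  set S : Set (Euc d × Euc d) := {p | dist p.2 0 ≤ r₁ ∧ dist p.2 p.1 ≤ r₂} with hS
  have hSm : MeasurableSet S :=
    (measurableSet_le (measurable_snd.dist measurable_const) measurable_const).inter
      (measurableSet_le (measurable_snd.dist measurable_fst) measurable_const)
  have h1 := Measure.prod_apply (μ := (volume : Measure (Euc d))) (ν := (volume : Measure (Euc d))) hSm
  have h2 := Measure.prod_apply_symm (μ := (volume : Measure (Euc d)))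
    (ν := (volume : Measure (Euc d))) hSm
  have e1 : ∀ x : Euc d, Prod.mk x ⁻¹' S = closedBall (0 : Euc d) r₁ ∩ closedBall x r₂ := by
    intro x; ext y; rfl
  have e2 : ∀ y : Euc d, volume ((fun x => (x, y)) ⁻¹' S) =
      (closedBall (0 : Euc d) r₁).indicator (fun _ => volume (closedBall (0 : Euc d) r₂)) y := by
    intro y
    by_cases hy : y ∈ closedBall (0 : Euc d) r₁
    · rw [indicator_of_mem hy, ← Measure.addHaar_closedBall_center volume y r₂]
      congr 1
      ext x
      constructor
      · rintro ⟨_, hx⟩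
        exact (dist_comm _ _).trans_le hx
      · intro hx
        exact ⟨hy, (dist_comm _ _).trans_le hx⟩
    · rw [indicator_of_notMem hy]
      have : (fun x => (x, y)) ⁻¹' S = ∅ := by
        ext x
        constructor
        · rintro ⟨hx, _⟩
          exact hy hx
        · intro hx; exact hx.elim
      rw [this, measure_empty]
  simp_rw [e1] at h1
  simp_rw [e2] at h2
  rw [← h1, h2, lintegral_indicator measurableSet_closedBall, setLIntegral_const, mul_comm]

lemma interVol_meas2 (d : ℕ) :
    Measurable (fun p : (ℝ × ℝ) × Euc d => interVol d 0 p.1.1 p.2 p.1.2) :=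
  (interVol_measurable d).comp (f := fun p : (ℝ × ℝ) × Euc d => ((0, p.1.1), (p.2, p.1.2)))
    (by fun_prop)

lemma interVol_int_x (d : ℕ) (r₁ r₂ : ℝ) :
    Integrable (fun x : Euc d => interVol d 0 r₁ x r₂) ∧
      ∫ x : Euc d, interVol d 0 r₁ x r₂ = ballVol d r₁ * ballVol d r₂ := by
  have hl := interVol_lint d r₁ r₂
  have hm : Measurable (fun x : Euc d => interVol d 0 r₁ x r₂) :=
    (interVol_meas2 d).comp (f := fun x : Euc d => ((r₁, r₂), x)) (by fun_prop)
  have ho : ∀ x : Euc d, ENNReal.ofReal (interVol d 0 r₁ x r₂) =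
      volume (closedBall (0 : Euc d) r₁ ∩ closedBall x r₂) := fun x =>
    ENNReal.ofReal_toReal (measure_ne_top_of_subset inter_subset_left (vol_closedBall_ne_top d _ _))
  constructor
  · refine ⟨hm.aestronglyMeasurable, ?_⟩
    rw [hasFiniteIntegral_iff_ofReal (Eventually.of_forall fun x => interVol_nonneg ..)]
    simp_rw [ho]
    rw [hl]
    exact ENNReal.mul_lt_top (vol_closedBall_ne_top d _ _).lt_top (vol_closedBall_ne_top d _ _).lt_top
  · rw [integral_eq_lintegral_of_nonneg_ae (Eventually.of_forall fun x => interVol_nonneg ..)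
      hm.aestronglyMeasurable]
    simp_rw [ho]
    rw [hl, ENNReal.toReal_mul]
    rfl

lemma bv_int (hmom : Integrable (fun r : ℝ => r ^ d) F) : Integrable (ballVol d) F := by
  simpa using ballVol_integrable hmom 0

lemma W_int (hmom : Integrable (fun r : ℝ => r ^ d) F) :
    Integrable (fun p : (ℝ × ℝ) × Euc d => interVol d 0 p.1.1 p.2 p.1.2)
      ((F.prod F).prod volume) := by
  rw [integrable_prod_iff (interVol_meas2 d).aestronglyMeasurable]
  constructor
  · exact Eventually.of_forall fun p => (interVol_int_x d p.1 p.2).1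
  · refine ((bv_int hmom).mul_prod (bv_int hmom)).congr (Eventually.of_forall fun p => ?_)
    simp only [Real.norm_of_nonneg (interVol_nonneg ..)]
    exact (interVol_int_x d p.1 p.2).2.symm

/-- integral of the weight times a function of the radii -/
lemma W_integral {k : ℝ × ℝ → ℝ} (hInt : Integrable
      (fun p : (ℝ × ℝ) × Euc d => interVol d 0 p.1.1 p.2 p.1.2 * k p.1) ((F.prod F).prod volume)) :
    ∫ p, interVol d 0 p.1.1 p.2 p.1.2 * k p.1 ∂((F.prod F).prod (volume : Measure (Euc d))) =
      ∫ p, ballVol d p.1 * ballVol d p.2 * k p ∂(F.prod F) := by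
  rw [integral_prod _ hInt]
  congr 1
  ext p
  dsimp only
  rw [integral_mul_const, (interVol_int_x d p.1 p.2).2]

lemma W_bad (hlam : 0 < lam) {α : ℝ} (h : RV F α)
    (hs : ∀ᵐ s ∂F, 0 ≤ s) (hmom : Integrable (fun r : ℝ => r ^ d) F)
    (hRR : ∀ᵐ p ∂((F.prod F).prod (volume : Measure (Euc d))), 0 ≤ p.1.1 ∧ 0 ≤ p.1.2)
    (U : (ℝ × ℝ) × Euc d → ℝ) (v : ℝ) :
    ∫ p in {p : (ℝ × ℝ) × Euc d | v < p.1.1 ∨ v < p.1.2},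
      interVol d 0 p.1.1 p.2 p.1.2 * |qR d lam F (U p) p.1.1 p.1.2|
        ∂((F.prod F).prod (volume : Measure (Euc d))) ≤
      (2 / lam * ∫ r, ballVol d r ∂F) * tailF F v := by
  set k : ℝ → ℝ := (Ioi v).indicator (hR d lam F) with hk
  have hkm : Measurable k := (hR_measurable hmom lam).indicator measurableSet_Ioi
  have hk0 : ∀ r, 0 ≤ k r := fun r => indicator_nonneg (fun r _ => hR_nonneg hlam r) r
  have hk1 : ∀ r, k r ≤ 1 := fun r => by
    by_cases hr : r ∈ Ioi v
    · rw [hk, indicator_of_mem hr]; exact hR_le_one hlam r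
    · rw [hk, indicator_of_notMem hr]; exact zero_le_one
  have hb : MeasurableSet {p : (ℝ × ℝ) × Euc d | v < p.1.1 ∨ v < p.1.2} :=
    (measurableSet_lt measurable_const measurable_fst.fst).union
      (measurableSet_lt measurable_const measurable_fst.snd)
  have hgi : ∀ f : ℝ × ℝ → ℝ, Measurable f → (∀ p, 0 ≤ f p) → (∀ p, f p ≤ 1) → Integrable
      (fun p : (ℝ × ℝ) × Euc d => interVol d 0 p.1.1 p.2 p.1.2 * f p.1)
      ((F.prod F).prod volume) := by
    intro f hf h0 h1
    refine (W_int hmom).mono' ((interVol_meas2 d).mul (hf.comp measurable_fst)).aestronglyMeasurable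
      (Eventually.of_forall fun p => ?_)
    rw [Real.norm_of_nonneg (mul_nonneg (interVol_nonneg ..) (h0 _))]
    exact mul_le_of_le_one_right (interVol_nonneg ..) (h1 _)
  have g1 := hgi (fun p => k p.1) (hkm.comp measurable_fst) (fun p => hk0 _) (fun p => hk1 _)
  have g2 := hgi (fun p => k p.2) (hkm.comp measurable_snd) (fun p => hk0 _) (fun p => hk1 _)
  have hkb : ∫ r, k r * ballVol d r ∂F ≤ 1 / lam * tailF F v := by
    have e : ∫ r, (Ioi v).indicator (fun _ => 1 / lam) r ∂F = 1 / lam * tailF F v := by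
      rw [integral_indicator measurableSet_Ioi, setIntegral_const, smul_eq_mul, mul_comm]
      rfl
    rw [← e]
    refine integral_mono_of_nonneg
      (Eventually.of_forall fun r => mul_nonneg (hk0 r) (ballVol_nonneg d r))
      ((integrable_const _).indicator measurableSet_Ioi) ?_
    filter_upwards [hs] with r hr
    by_cases hrv : r ∈ Ioi v
    · rw [hk, indicator_of_mem hrv, indicator_of_mem hrv]
      exact hR_le hmom h hlam hr hs
    · rw [hk, indicator_of_notMem hrv, indicator_of_notMem hrv, zero_mul]
  have hB : 0 ≤ ∫ r, ballVol d r ∂F := integral_nonneg fun r => ballVol_nonneg d r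
  rw [← integral_indicator hb]
  calc _ ≤ ∫ p, (interVol d 0 p.1.1 p.2 p.1.2 * k p.1.1 + interVol d 0 p.1.1 p.2 p.1.2 * k p.1.2)
        ∂((F.prod F).prod (volume : Measure (Euc d))) := by
        refine integral_mono_of_nonneg (Eventually.of_forall fun p => ?_) (g1.add g2) ?_
        · exact indicator_nonneg (fun p _ => mul_nonneg (interVol_nonneg ..) (abs_nonneg _)) p
        · filter_upwards [hRR] with p hp
          have hi := interVol_nonneg d 0 p.1.1 p.2 p.1.2
          obtain ⟨q1, q2⟩ := qR_le_h hlam hmom h (U p) hp.1 hp.2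
          by_cases hpb : p ∈ {p : (ℝ × ℝ) × Euc d | v < p.1.1 ∨ v < p.1.2}
          · rw [indicator_of_mem hpb, ← mul_add]
            refine mul_le_mul_of_nonneg_left ?_ hi
            rcases hpb with hv | hv
            · have : k p.1.1 = hR d lam F p.1.1 := indicator_of_mem (s := Ioi v) hv _
              have := hk0 p.1.2
              linarith
            · have : k p.1.2 = hR d lam F p.1.2 := indicator_of_mem (s := Ioi v) hv _
              have := hk0 p.1.1
              linarith
          · rw [indicator_of_notMem hpb]
            have := hk0 p.1.1
            have := hk0 p.1.2
            positivity
    _ = (∫ r, k r * ballVol d r ∂F) * (∫ r, ballVol d r ∂F) +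
          (∫ r, ballVol d r ∂F) * (∫ r, k r * ballVol d r ∂F) := by
        rw [integral_add g1 g2, W_integral (k := fun p => k p.1) g1,
          W_integral (k := fun p => k p.2) g2]
        rw [← integral_prod_mul, ← integral_prod_mul]
        congr 1
        · refine integral_congr_ae (Eventually.of_forall fun p => ?_)
          simp only; ring
        · refine integral_congr_ae (Eventually.of_forall fun p => ?_)
          simp only; ring
    _ = 2 * ((∫ r, ballVol d r ∂F) * (∫ r, k r * ballVol d r ∂F)) := by ring
    _ ≤ 2 * ((∫ r, ballVol d r ∂F) * (1 / lam * tailF F v)) := by gcongr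
    _ = _ := by ring

lemma part2 (hd : 0 < d) (hlam : 0 < lam) {α L : ℝ} (h : RV F α) (hα : (d : ℝ) < α)
    (hs : ∀ᵐ s ∂F, 0 ≤ s) (hmom : Integrable (fun r : ℝ => r ^ d) F) (hLp : 0 < L)
    (hL : Tendsto (fun u => NN d F u / tailF F u) atTop (nhds L)) :
    ∃ c > 0, Tendsto (fun z => kth d lam F (hR d lam F) (qR d lam F) z / gg d F ‖z‖)
      (comap norm atTop) (nhds c) := by
  have hn : Tendsto (fun z : Euc d => ‖z‖) (comap norm atTop) atTop := tendsto_comap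
  have hRR : ∀ᵐ p ∂((F.prod F).prod (volume : Measure (Euc d))), 0 ≤ p.1.1 ∧ 0 ≤ p.1.2 := by
    have h1 : ∀ᵐ p ∂(F.prod F), 0 ≤ p.1 := Measure.quasiMeasurePreserving_fst.ae hs
    have h2 : ∀ᵐ p ∂(F.prod F), 0 ≤ p.2 := Measure.quasiMeasurePreserving_snd.ae hs
    exact Measure.quasiMeasurePreserving_fst.ae (h1.and h2)
  have hg := generic (μ := (F.prod F).prod (volume : Measure (Euc d)))
    (W := fun p => interVol d 0 p.1.1 p.2 p.1.2) (R1 := fun p => p.1.1) (R2 := fun p => p.1.2)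
    (U := fun (z : Euc d) p => ‖p.2 - z‖ ) hd hlam h hα hs hmom hLp hL (W_int hmom)
    (fun _ => interVol_nonneg ..) measurable_fst.fst measurable_fst.snd hRR
    (fun _ => by fun_prop) (fun z p hW h1 h2 => by
      have hx : ‖p.2‖ ≤ p.1.1 + p.1.2 := by
        by_contra hcon
        apply hW
        apply interVol_eq_zero
        rw [dist_zero_left]
        exact not_le.1 hcon
      have h3 := norm_sub_norm_le z p.2
      have h4 := norm_sub_le p.2 z
      rw [norm_sub_rev] at h3
      rw [abs_le]
      constructor <;> linarith)
    (fun z hz => W_bad hlam h hs hmom hRR (fun p => ‖p.2 - z‖) (‖z‖ / 16))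
  have hWG : Integrable (fun p : (ℝ × ℝ) × Euc d => interVol d 0 p.1.1 p.2 p.1.2 *
      GG d lam F p.1.1 p.1.2) ((F.prod F).prod volume) := by
    refine (W_int hmom).mono' ((interVol_meas2 d).mul
      ((GG_measurable hmom).comp measurable_fst)).aestronglyMeasurable
      (Eventually.of_forall fun p => ?_)
    rw [Real.norm_of_nonneg (mul_nonneg (interVol_nonneg ..) (GG_nonneg _ _))]
    exact mul_le_of_le_one_right (interVol_nonneg ..) (GG_le_one hlam _ _)
  have hGpos : 0 < ∫ p, interVol d 0 p.1.1 p.2 p.1.2 * GG d lam F p.1.1 p.1.2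
      ∂((F.prod F).prod (volume : Measure (Euc d))) := by
    rw [integral_pos_iff_support_of_nonneg
      (fun p => mul_nonneg (interVol_nonneg ..) (GG_nonneg _ _)) hWG]
    have hsub : (Ioi (1:ℝ) ×ˢ Ioi (1:ℝ)) ×ˢ closedBall (0 : Euc d) 1 ⊆ Function.support
        (fun p : (ℝ × ℝ) × Euc d => interVol d 0 p.1.1 p.2 p.1.2 * GG d lam F p.1.1 p.1.2) := by
      rintro ⟨⟨r1, r2⟩, x⟩ ⟨⟨h1, h2⟩, hx⟩
      simp only [mem_Ioi] at h1 h2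
      have hx' : dist (0 : Euc d) x ≤ 1 := by rw [dist_comm]; exact hx
      have := interVol_pos_mid d 0 r1 x r2 (ε := 1 / 2) (by norm_num) (by linarith) (by linarith)
      exact (mul_pos this (GG_pos hlam _ _)).ne'
    refine lt_of_lt_of_le ?_ (measure_mono hsub)
    rw [Measure.prod_prod, Measure.prod_prod]
    have hT : F (Ioi 1) ≠ 0 := by
      intro h0
      have := h.pos 1 one_pos
      simp [tailF, h0] at this
    exact ENNReal.mul_pos (mul_ne_zero hT hT) (measure_closedBall_pos _ _ one_pos).ne'
  have hfirst : Tendsto (fun z : Euc d => (lam * ∫ r, interVol d 0 r z r * hR d lam F r ∂F) /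
      gg d F ‖z‖) (comap norm atTop) (nhds 0) := by
    refine squeeze_zero' ?_ ?_ ((tail_neg hd h).comp hn)
    · filter_upwards [hn.eventually (eventually_gt_atTop 0)] with z hz
      have := integral_nonneg (μ := F) (f := fun r => interVol d 0 r z r * hR d lam F r)
        fun r => mul_nonneg (interVol_nonneg ..) (hR_nonneg hlam r)
      have := (gg_pos (d := d) h hz).le
      positivity
    · filter_upwards [hn.eventually (eventually_gt_atTop 0)] with z hz
      have := (gg_pos (d := d) h hz).le
      simp only [Function.comp]
      gcongr
      have e : ∫ r, (Ioi (‖z‖ / 16)).indicator (fun _ => 1 / lam) r ∂F =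
          1 / lam * tailF F (‖z‖ / 16) := by
        rw [integral_indicator measurableSet_Ioi, setIntegral_const, smul_eq_mul, mul_comm]
        rfl
      have h2 : ∫ r, interVol d 0 r z r * hR d lam F r ∂F ≤ 1 / lam * tailF F (‖z‖ / 16) := by
        rw [← e]
        refine integral_mono_of_nonneg
          (Eventually.of_forall fun r => mul_nonneg (interVol_nonneg ..) (hR_nonneg hlam r))
          ((integrable_const _).indicator measurableSet_Ioi) ?_
        filter_upwards [hs] with r hr
        by_cases hrv : r ∈ Ioi (‖z‖ / 16)
        · rw [indicator_of_mem hrv]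
          refine le_trans ?_ (hR_le hmom h hlam hr hs)
          rw [mul_comm]
          exact mul_le_mul_of_nonneg_left (interVol_le_left ..) (hR_nonneg hlam r)
        · rw [indicator_of_notMem hrv, interVol_eq_zero, zero_mul]
          rw [dist_zero_left]
          simp only [mem_Ioi, not_lt] at hrv
          linarith
      calc lam * ∫ r, interVol d 0 r z r * hR d lam F r ∂F
          ≤ lam * (1 / lam * tailF F (‖z‖ / 16)) := by gcongr
        _ = tailF F (‖z‖ / 16) := by field_simp
  have := hfirst.add (hg.const_mul (lam ^ 2))
  rw [zero_add] at this
  refine ⟨_, ?_, this.congr fun z => ?_⟩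
  · positivity
  · have hWq : Integrable (fun p : (ℝ × ℝ) × Euc d => interVol d 0 p.1.1 p.2 p.1.2 *
        qR d lam F ‖p.2 - z‖ p.1.1 p.1.2) ((F.prod F).prod volume) := by
      refine (W_int hmom).mono' ((interVol_meas2 d).mul
        ((qR_measurable hmom).comp (f := fun p : (ℝ × ℝ) × Euc d => (‖p.2 - z‖, p.1.1, p.1.2))
          (by fun_prop))).aestronglyMeasurable
        (Eventually.of_forall fun p => ?_)
      rw [norm_mul, Real.norm_of_nonneg (interVol_nonneg ..)]
      exact mul_le_of_le_one_right (interVol_nonneg ..) (qR_abs_le hlam hmom _ _ _).2.2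
    have e : ∫ p, interVol d 0 p.1.1 p.2 p.1.2 * qR d lam F ‖p.2 - z‖ p.1.1 p.1.2
        ∂((F.prod F).prod (volume : Measure (Euc d))) =
        ∫ r₁, (∫ r₂, (∫ x, interVol d 0 r₁ x r₂ * qR d lam F (‖x - z‖) r₁ r₂) ∂F) ∂F := by
      rw [integral_prod _ hWq, integral_prod _ hWq.integral_prod_left]
    unfold kth
    rw [e]
    ring

lemma div_lim {α c : ℝ} {ℓ : ℝ → ℝ} (hc : 0 < c)
    (htail : ∀ x > 0, tailF F x = ℓ x * x ^ (-α)) {k : Euc d → ℝ}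
    (hk : Tendsto (fun z => k z / gg d F ‖z‖) (comap norm atTop) (nhds c)) :
    Tendsto (fun z => k z / (c * ℓ ‖z‖ * ‖z‖ ^ (-(α - d)))) (comap norm atTop) (nhds 1) := by
  have hn : Tendsto (fun z : Euc d => ‖z‖) (comap norm atTop) atTop := tendsto_comap
  have h1 := hk.div_const c
  rw [div_self hc.ne'] at h1
  refine h1.congr' ?_
  filter_upwards [hn.eventually (eventually_gt_atTop 0)] with z hz
  have e : gg d F ‖z‖ = ℓ ‖z‖ * ‖z‖ ^ (-(α - d)) := by
    unfold gg
    rw [htail _ hz, ← Real.rpow_natCast, mul_left_comm, ← Real.rpow_add hz]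
    congr 2
    ring
  rw [e, div_div, mul_comm _ c, mul_assoc c]

end final2

/-- Matérn type II (random grains retained): power-law decay of the radius tail
(with exponent `α + d`), of the covariance of the grain cover, and of the two-point
correlation of the grain centers (with exponent `α - d`). -/
theorem stmt14 (d : ℕ) (hd : 0 < d) (lam : ℝ) (hlam : 0 < lam)
    (F : Measure ℝ) [IsProbabilityMeasure F] (hsupp : F (Iio 0) = 0)
    (hmom : Integrable (fun r : ℝ => r ^ d) F)
    (α : ℝ) (hα : (d : ℝ) < α)
    (ℓ : ℝ → ℝ) (hℓ : SlowlyVarying ℓ)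
    (htail : ∀ x > 0, tailF F x = ℓ x * x ^ (-α)) :
    Tendsto
      (fun r =>
        tailth lam F (hR d lam F) r /
          ((lamth lam F (hR d lam F) * ballVol d 1)⁻¹ * (α / (α + d)) * ℓ r *
            r ^ (-(α + d))))
      atTop (nhds 1) ∧
    ∃ c₁ > 0, ∃ c₂ > 0,
      Tendsto
        (fun z : Euc d =>
          kth d lam F (hR d lam F) (qR d lam F) z / (c₁ * ℓ ‖z‖ * ‖z‖ ^ (-(α - d))))
        (comap norm atTop) (nhds 1) ∧
      Tendsto
        (fun z : Euc d =>
          xith d lam F (hR d lam F) (qR d lam F) z / (c₂ * ℓ ‖z‖ * ‖z‖ ^ (-(α - d))))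
        (comap norm atTop) (nhds 1) := by
  have hs : ∀ᵐ s ∂F, 0 ≤ s := by
    rw [ae_iff]
    have e : {a : ℝ | ¬ 0 ≤ a} = Iio 0 := by ext a; simp
    rw [e]; exact hsupp
  have h : RV F α := ⟨tail_pos hℓ htail, tail_anti F, tail_rv hℓ htail⟩
  obtain ⟨L, hLp, hL⟩ := NN_lim hd h hα hmom
  obtain ⟨c₁, hc1, h1⟩ := part2 hd hlam h hα hs hmom hLp hL
  obtain ⟨c₂, hc2, h2⟩ := part3 hd hlam h hα hs hmom hLp hL
  exact ⟨part1 d hd lam hlam F hs hmom α hα h ℓ htail, c₁, hc1, c₂, hc2,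
    div_lim hc1 htail h1, div_lim hc2 htail h2⟩
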